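/- Let d ≥ 1. Let μ = e^{-V(x)} dx and ν = e^{-W(x)} dx be probability measures on ℝ^d, where V, W : ℝ^d → ℝ are twice continuously differentiable, W is convex, and the Legendre transform W* is finite and twice continuously differentiable on ℝ^d. Assume there are constants Λ_V, λ_W > 0 such that ΔV(x) ≤ Λ_V and ΔW*(x) ≤ 1/λ_W for all x ∈ ℝ^d. Let φ : ℝ^d → ℝ be a twice continuously differentiable convex function whose gradient pushes μ forward to ν (the Brenier map from μ to ν). Then Δφ(x) ≤ √(Λ_V/λ_W) for every x ∈ ℝ^d. -/

import Mathlib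

open MeasureTheory Matrix
open scoped RealInnerProductSpace

/-- The Hessian matrix of `f : ℝ^d → ℝ` at `x`, with entries the second derivatives
in the coordinate directions. -/
noncomputable def hessianMatrix {d : ℕ} (f : EuclideanSpace ℝ (Fin d) → ℝ)
    (x : EuclideanSpace ℝ (Fin d)) : Matrix (Fin d) (Fin d) ℝ :=
  Matrix.of fun i j =>
    iteratedFDeriv ℝ 2 f x ![EuclideanSpace.single i (1:ℝ), EuclideanSpace.single j (1:ℝ)]

section SecondDerivative

variable {F : Type*} [NormedAddCommGroup F] [NormedSpace ℝ F] {f : F → ℝ}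

lemma hasDerivAt_add_smul (x v : F) (s : ℝ) : HasDerivAt (fun s : ℝ => x + s • v) v s := by
  simpa using ((hasDerivAt_id s).smul_const v).const_add x

lemma ContDiff.hasDerivAt_comp_add_smul (hf : ContDiff ℝ 1 f) (x v : F) (s : ℝ) :
    HasDerivAt (fun s : ℝ => f (x + s • v)) (fderiv ℝ f (x + s • v) v) s :=
  ((hf.differentiable one_ne_zero _).hasFDerivAt.comp_hasDerivAt s (hasDerivAt_add_smul x v s))

lemma ContDiff.hasDerivAt_fderiv_comp_add_smul (hf : ContDiff ℝ 2 f) (x v u : F) (s : ℝ) :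
    HasDerivAt (fun s : ℝ => fderiv ℝ f (x + s • v) u)
      (fderiv ℝ (fderiv ℝ f) (x + s • v) v u) s := by
  have h1 : ContDiff ℝ 1 (fderiv ℝ f) := hf.fderiv_right (by norm_num)
  have h := (h1.differentiable one_ne_zero (x + s • v)).hasFDerivAt.comp_hasDerivAt s
    (hasDerivAt_add_smul x v s)
  simpa using h.clm_apply (hasDerivAt_const s u)

lemma ConvexOn.add_fderiv_le (hc : ConvexOn ℝ Set.univ f) (hf : ContDiff ℝ 1 f) (x y : F) :
    f x + fderiv ℝ f x (y - x) ≤ f y := by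
  have hg : ConvexOn ℝ Set.univ (fun s : ℝ => f (x + s • (y - x))) := by
    have := hc.comp_affineMap (AffineMap.lineMap (k := ℝ) x y)
    simpa [Function.comp_def, AffineMap.lineMap_apply, add_comm] using this
  have hd := hf.hasDerivAt_comp_add_smul x (y - x) 0
  have := hg.le_slope_of_hasDerivAt (Set.mem_univ 0) (Set.mem_univ 1) one_pos hd
  simp [slope_def_field] at this
  rw [map_sub]
  linarith

lemma ConvexOn.fderiv_sub_fderiv_nonneg (hc : ConvexOn ℝ Set.univ f) (hf : ContDiff ℝ 1 f)
    (x y : F) : fderiv ℝ f x (y - x) ≤ fderiv ℝ f y (y - x) := by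
  have h1 := hc.add_fderiv_le hf x y
  have h2 := hc.add_fderiv_le hf y x
  have : fderiv ℝ f y (x - y) = - fderiv ℝ f y (y - x) := by rw [← map_neg, neg_sub]
  linarith

lemma ConvexOn.monotone_fderiv_comp_add_smul (hc : ConvexOn ℝ Set.univ f) (hf : ContDiff ℝ 1 f)
    (x v : F) : Monotone (fun s : ℝ => fderiv ℝ f (x + s • v) v) := by
  intro s t hst
  rcases hst.eq_or_lt with rfl | hst
  · rfl
  have h := hc.fderiv_sub_fderiv_nonneg hf (x + s • v) (x + t • v)
  have : x + t • v - (x + s • v) = (t - s) • v := by rw [sub_smul]; abel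
  rw [this, map_smul, map_smul, smul_eq_mul, smul_eq_mul] at h
  exact le_of_mul_le_mul_left h (sub_pos.2 hst)

lemma ConvexOn.fderiv_fderiv_nonneg (hc : ConvexOn ℝ Set.univ f) (hf : ContDiff ℝ 2 f)
    (x v : F) : 0 ≤ fderiv ℝ (fderiv ℝ f) x v v := by
  have h := (hf.hasDerivAt_fderiv_comp_add_smul x v v 0).nonneg_of_monotone
    (hc.monotone_fderiv_comp_add_smul (hf.of_le (by norm_num)) x v)
  simpa using h

end SecondDerivative

lemma IsLocalMax.second_deriv_nonpos {γ γ₁ : ℝ → ℝ} {γ₂ a : ℝ} (hmax : IsLocalMax γ a)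
    (h₁ : ∀ s, HasDerivAt γ (γ₁ s) s) (h₂ : HasDerivAt γ₁ γ₂ a) : γ₂ ≤ 0 := by
  by_contra! hpos
  have hd : deriv γ = γ₁ := funext fun s => (h₁ s).deriv
  have hmin : IsLocalMin γ a := isLocalMin_of_deriv_deriv_pos (by rw [hd, h₂.deriv]; exact hpos)
    hmax.deriv_eq_zero (h₁ a).continuousAt
  have heq : γ =ᶠ[nhds a] fun _ => γ a := by
    filter_upwards [hmin, hmax] with s hs ht using le_antisymm ht hs
  have := heq.deriv.deriv_eq
  rw [hd, h₂.deriv] at this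
  simp at this
  exact hpos.ne' this

section ParametricIntegral

variable {X : Type*} [TopologicalSpace X] [MeasurableSpace X] [BorelSpace X]
  {m : Measure X} [IsFiniteMeasure m] {K : Set X}

lemma Continuous.integrable_of_measure_compl_eq_zero (hK : IsCompact K) (hm : m Kᶜ = 0)
    {g : X → ℝ} (hg : Continuous g) : Integrable g m := by
  obtain ⟨C, hC⟩ := hK.exists_bound_of_continuousOn hg.continuousOn
  refine Integrable.of_bound hg.aestronglyMeasurable C ?_
  filter_upwards [measure_eq_zero_iff_ae_notMem.1 hm] with w hw
  exact hC w (not_not.1 hw)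

lemma hasDerivAt_integral_of_continuous (hK : IsCompact K) (hm : m Kᶜ = 0) {g g' : ℝ → X → ℝ}
    (hg : Continuous (Function.uncurry g)) (hg' : Continuous (Function.uncurry g'))
    (hd : ∀ s w, HasDerivAt (fun s => g s w) (g' s w) s) (s : ℝ) :
    HasDerivAt (fun s => ∫ w, g s w ∂m) (∫ w, g' s w ∂m) s := by
  obtain ⟨C, hC⟩ := ((isCompact_closedBall s 1).prod hK).exists_bound_of_continuousOn
    hg'.continuousOn
  refine (hasDerivAt_integral_of_dominated_loc_of_deriv_le (bound := fun _ => C)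
    (Metric.closedBall_mem_nhds s one_pos) ?_ ?_ ?_ ?_ (integrable_const C) ?_).2
  · exact .of_forall fun t => (hg.comp (Continuous.prodMk_right t)).aestronglyMeasurable
  · exact (hg.comp (Continuous.prodMk_right s)).integrable_of_measure_compl_eq_zero hK hm
  · exact (hg'.comp (Continuous.prodMk_right s)).aestronglyMeasurable
  · filter_upwards [measure_eq_zero_iff_ae_notMem.1 hm] with w hw t ht
    exact hC (t, w) ⟨ht, not_not.1 hw⟩
  · exact .of_forall fun w t _ => hd t w

lemma continuous_integral_of_continuous {Y : Type*} [TopologicalSpace Y]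
    [FirstCountableTopology Y] [LocallyCompactSpace Y]
    (hK : IsCompact K) (hm : m Kᶜ = 0) {g : Y → X → ℝ}
    (hg : Continuous (Function.uncurry g)) : Continuous fun y => ∫ w, g y w ∂m := by
  have h := continuous_parametric_integral_of_continuous (μ := m) hg hK
  have hr : m.restrict K = m := Measure.restrict_eq_self_of_ae_mem (by
    filter_upwards [measure_eq_zero_iff_ae_notMem.1 hm] with w hw using not_not.1 hw)
  rwa [hr] at h

end ParametricIntegral

section LogDet

open scoped MatrixOrder Matrix.Norms.L2Operator

variable {n : Type*} [Fintype n] [DecidableEq n]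

lemma Matrix.PosDef.log_det_le {M : Matrix n n ℝ} (hM : M.PosDef) :
    Real.log M.det ≤ M.trace - Fintype.card n := by
  have h1 : M.det = ∏ i, hM.1.eigenvalues i := by simpa using hM.1.det_eq_prod_eigenvalues
  have h2 : M.trace = ∑ i, hM.1.eigenvalues i := by simpa using hM.1.trace_eq_sum_eigenvalues
  rw [h1, h2, Real.log_prod fun i _ => (hM.eigenvalues_pos i).ne']
  calc ∑ i, Real.log (hM.1.eigenvalues i) ≤ ∑ i, (hM.1.eigenvalues i - 1) :=
        Finset.sum_le_sum fun i _ => Real.log_le_sub_one_of_pos (hM.eigenvalues_pos i)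
    _ = _ := by simp

lemma Matrix.PosDef.exists_conj_eq_one {A : Matrix n n ℝ} (hA : A.PosDef) :
    ∃ P : Matrix n n ℝ, IsUnit P ∧ Pᴴ * A * P = 1 := by
  obtain ⟨S, hS⟩ := CStarAlgebra.nonneg_iff_eq_star_mul_self.mp hA.posSemidef.nonneg
  have hSdet : IsUnit S.det := by
    have := hA.det_pos.ne'
    rw [hS, det_mul] at this
    exact (right_ne_zero_of_mul this).isUnit
  refine ⟨S⁻¹, (isUnit_nonsing_inv_iff).2 ((isUnit_iff_isUnit_det S).2 hSdet), ?_⟩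
  rw [hS, star_eq_conjTranspose, ← Matrix.mul_assoc, ← conjTranspose_mul, Matrix.mul_assoc,
    Matrix.mul_nonsing_inv _ hSdet]
  simp

lemma Matrix.PosSemidef.dotProduct_mulVec_le_trace {A : Matrix n n ℝ} (hA : A.PosSemidef)
    (v : n → ℝ) : v ⬝ᵥ (A *ᵥ v) ≤ A.trace * ∑ i, v i ^ 2 := by
  obtain ⟨S, rfl⟩ := CStarAlgebra.nonneg_iff_eq_star_mul_self.mp hA.nonneg
  have h1 : v ⬝ᵥ ((star S * S) *ᵥ v) = ∑ i, (∑ j, S i j * v j) ^ 2 := by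
    rw [← mulVec_mulVec, dotProduct_mulVec, star_eq_conjTranspose, vecMul_conjTranspose]
    simp [dotProduct, mulVec, sq]
  have h2 : (star S * S).trace = ∑ i, ∑ j, S i j ^ 2 := by
    rw [star_eq_conjTranspose, Finset.sum_comm]
    simp [Matrix.trace, mul_apply, sq]
  rw [h1, h2, Finset.sum_mul]
  exact Finset.sum_le_sum fun i _ => Finset.sum_mul_sq_le_sq_mul_sq _ _ _

lemma Matrix.PosDef.exists_log_det_le {A : Matrix n n ℝ} (hA : A.PosDef) :
    ∃ v : n → n → ℝ, ∑ j, v j ⬝ᵥ (A *ᵥ v j) = Fintype.card n ∧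
      ∀ B : Matrix n n ℝ, B.PosDef →
        Real.log B.det ≤ Real.log A.det + ∑ j, v j ⬝ᵥ (B *ᵥ v j) - Fintype.card n := by
  obtain ⟨P, hP, hPA⟩ := hA.exists_conj_eq_one
  have htr : ∀ B : Matrix n n ℝ, ∑ j, P.col j ⬝ᵥ (B *ᵥ P.col j) = (Pᴴ * B * P).trace := by
    intro B
    refine Finset.sum_congr rfl fun j _ => ?_
    rw [diag_apply, Matrix.mul_assoc, mul_apply]
    rfl
  have hPdet : P.det ≠ 0 := ((isUnit_iff_isUnit_det P).1 hP).ne_zero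
  have hdet : ∀ B : Matrix n n ℝ, B.PosDef →
      Real.log (Pᴴ * B * P).det = Real.log B.det + 2 * Real.log P.det := by
    intro B hB
    rw [det_mul, det_mul, det_conjTranspose, star_trivial,
      Real.log_mul (mul_ne_zero hPdet hB.det_pos.ne') hPdet, Real.log_mul hPdet hB.det_pos.ne']
    ring
  refine ⟨P.col, ?_, fun B hB => ?_⟩
  · rw [htr, hPA, trace_one]
  · have h1 := hdet A hA
    rw [hPA, det_one, Real.log_one] at h1
    have h2 := (hB.conjTranspose_mul_mul_same
      (mulVec_injective_of_isUnit hP)).log_det_le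
    rw [hdet B hB] at h2
    rw [htr]
    linarith

end LogDet

section Hessian

variable {d : ℕ} {f : EuclideanSpace ℝ (Fin d) → ℝ}

lemma hessianMatrix_apply (f : EuclideanSpace ℝ (Fin d) → ℝ) (x : EuclideanSpace ℝ (Fin d))
    (i j : Fin d) : hessianMatrix f x i j =
      fderiv ℝ (fderiv ℝ f) x (EuclideanSpace.single i 1) (EuclideanSpace.single j 1) := by
  simp [hessianMatrix, iteratedFDeriv_two_apply]

lemma trace_hessianMatrix (f : EuclideanSpace ℝ (Fin d) → ℝ) (x : EuclideanSpace ℝ (Fin d)) :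
    (hessianMatrix f x).trace = ∑ i, fderiv ℝ (fderiv ℝ f) x (EuclideanSpace.single i 1)
      (EuclideanSpace.single i 1) := by
  simp [Matrix.trace, hessianMatrix_apply]

lemma dotProduct_hessianMatrix_mulVec (f : EuclideanSpace ℝ (Fin d) → ℝ)
    (x : EuclideanSpace ℝ (Fin d)) (a b : Fin d → ℝ) :
    a ⬝ᵥ (hessianMatrix f x *ᵥ b) =
      fderiv ℝ (fderiv ℝ f) x (WithLp.toLp 2 a) (WithLp.toLp 2 b) := by
  have h : ∀ a : Fin d → ℝ, WithLp.toLp 2 a = ∑ i, a i • EuclideanSpace.single i (1 : ℝ) := by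
    intro a
    ext i
    simp [Pi.single_apply]
  rw [h a, h b]
  simp only [dotProduct, mulVec, hessianMatrix_apply, Finset.mul_sum, map_sum, map_smul,
    _root_.sum_apply, _root_.smul_apply, smul_eq_mul]
  rw [Finset.sum_comm]
  exact Finset.sum_congr rfl fun i _ => Finset.sum_congr rfl fun j _ => by ring

lemma ContDiff.continuous_fderiv_fderiv_apply (hf : ContDiff ℝ 2 f)
    (u v : EuclideanSpace ℝ (Fin d)) : Continuous fun x => fderiv ℝ (fderiv ℝ f) x u v := by
  have h1 : ContDiff ℝ 1 (fderiv ℝ f) := hf.fderiv_right (by norm_num)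
  have h2 : Continuous (fderiv ℝ (fderiv ℝ f)) := h1.continuous_fderiv one_ne_zero
  fun_prop

lemma ContDiff.continuous_hessianMatrix (hf : ContDiff ℝ 2 f) :
    Continuous (hessianMatrix f) := by
  refine continuous_matrix fun i j => ?_
  simp only [hessianMatrix_apply]
  exact hf.continuous_fderiv_fderiv_apply _ _

lemma ContDiff.isHermitian_hessianMatrix (hf : ContDiff ℝ 2 f) (x : EuclideanSpace ℝ (Fin d)) :
    (hessianMatrix f x).IsHermitian := by
  ext i j
  have := (hf.contDiffAt (x := x)).isSymmSndFDerivAt (by simp)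
  simp [hessianMatrix_apply, this.eq (EuclideanSpace.single i 1) (EuclideanSpace.single j 1)]

lemma ConvexOn.posSemidef_hessianMatrix (hc : ConvexOn ℝ Set.univ f) (hf : ContDiff ℝ 2 f)
    (x : EuclideanSpace ℝ (Fin d)) : (hessianMatrix f x).PosSemidef := by
  refine .of_dotProduct_mulVec_nonneg (hf.isHermitian_hessianMatrix x) fun v => ?_
  rw [star_trivial, dotProduct_hessianMatrix_mulVec]
  exact hc.fderiv_fderiv_nonneg hf _ _

lemma ConvexOn.fderiv_fderiv_le_trace (hc : ConvexOn ℝ Set.univ f) (hf : ContDiff ℝ 2 f)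
    (x v : EuclideanSpace ℝ (Fin d)) :
    fderiv ℝ (fderiv ℝ f) x v v ≤ (hessianMatrix f x).trace * ‖v‖ ^ 2 := by
  have h := (hc.posSemidef_hessianMatrix hf x).dotProduct_mulVec_le_trace v.ofLp
  rw [dotProduct_hessianMatrix_mulVec] at h
  simpa [EuclideanSpace.norm_sq_eq] using h

/-- The derivative of `gradient f`, with matrix `hessianMatrix f`. -/
lemma ContDiff.hasFDerivAt_gradient (hf : ContDiff ℝ 2 f) (x : EuclideanSpace ℝ (Fin d)) :
    ∃ A : EuclideanSpace ℝ (Fin d) →L[ℝ] EuclideanSpace ℝ (Fin d),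
      HasFDerivAt (fun x => gradient f x) A x ∧ A.det = (hessianMatrix f x).det := by
  have h1 : ContDiff ℝ 1 (fderiv ℝ f) := hf.fderiv_right (by norm_num)
  let J := (InnerProductSpace.toDual ℝ (EuclideanSpace ℝ (Fin d))).symm
  let Jc : StrongDual ℝ (EuclideanSpace ℝ (Fin d)) →L[ℝ] EuclideanSpace ℝ (Fin d) :=
    { toFun := J, map_add' := J.map_add, map_smul' := fun c y => by simp,
      cont := J.continuous }
  refine ⟨Jc ∘L fderiv ℝ (fderiv ℝ f) x, ?_, ?_⟩
  · exact Jc.hasFDerivAt.comp x (h1.differentiable one_ne_zero x).hasFDerivAt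
  · rw [ContinuousLinearMap.det, ← LinearMap.det_toMatrix
      (EuclideanSpace.basisFun (Fin d) ℝ).toBasis, ← det_transpose (hessianMatrix f x)]
    congr 1
    ext i j
    have : (fderiv ℝ (fderiv ℝ f) x) (EuclideanSpace.single j 1) (EuclideanSpace.single i 1) =
      ⟪J ((fderiv ℝ (fderiv ℝ f) x) (EuclideanSpace.single j 1)), EuclideanSpace.single i 1⟫ := by
      simp [J]
    rw [LinearMap.toMatrix_apply, transpose_apply, hessianMatrix_apply, this,
      EuclideanSpace.inner_single_right]
    simp [Jc]

end Hessian

lemma hasDerivAt_max_zero_sq (t : ℝ) :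
    HasDerivAt (fun t : ℝ => max 0 t ^ 2) (2 * max 0 t) t := by
  rcases lt_trichotomy t 0 with ht | rfl | ht
  · have h : (fun t : ℝ => max 0 t ^ 2) =ᶠ[nhds t] fun _ => 0 := by
      filter_upwards [Iio_mem_nhds ht] with s hs
      simp [max_eq_left (le_of_lt (Set.mem_Iio.1 hs))]
    simpa [max_eq_left ht.le] using (hasDerivAt_const t (0 : ℝ)).congr_of_eventuallyEq h
  · rw [hasDerivAt_iff_isLittleO]
    have h : (fun t : ℝ => t ^ 2) =o[nhds 0] fun t => t := by
      simpa using Asymptotics.isLittleO_pow_id one_lt_two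
    refine (Asymptotics.IsBigO.of_bound 1 (.of_forall fun s => ?_)).trans_isLittleO
      (h.congr_right fun s => (sub_zero s).symm)
    rcases le_total 0 s with hs | hs <;> simp [hs, sq_nonneg]
  · have h : (fun t : ℝ => max 0 t ^ 2) =ᶠ[nhds t] fun t => t ^ 2 := by
      filter_upwards [Ioi_mem_nhds ht] with s hs
      simp [max_eq_right (le_of_lt (Set.mem_Ioi.1 hs))]
    simpa [max_eq_right ht.le] using (hasDerivAt_pow 2 t).congr_of_eventuallyEq h

section BumpMeasure

variable {d : ℕ}

/-- The truncated paraboloid `(1 - ‖w‖²)₊`. -/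
noncomputable def paraboloid (w : EuclideanSpace ℝ (Fin d)) : ℝ := max 0 (1 - ‖w‖ ^ 2)

lemma paraboloid_nonneg (w : EuclideanSpace ℝ (Fin d)) : 0 ≤ paraboloid w := le_max_left _ _

lemma paraboloid_le_one (w : EuclideanSpace ℝ (Fin d)) : paraboloid w ≤ 1 :=
  max_le zero_le_one (by nlinarith [sq_nonneg ‖w‖])

lemma continuous_paraboloid : Continuous (paraboloid (d := d)) := by
  unfold paraboloid; fun_prop

lemma paraboloid_eq_zero {w : EuclideanSpace ℝ (Fin d)} (hw : 1 < ‖w‖) : paraboloid w = 0 :=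
  max_eq_left (by nlinarith)

lemma support_paraboloid_subset :
    Function.support (paraboloid (d := d)) ⊆ Metric.closedBall 0 1 := by
  intro w hw
  by_contra h
  exact hw (paraboloid_eq_zero (by simpa using h))

lemma hasCompactSupport_paraboloid : HasCompactSupport (paraboloid (d := d)) :=
  .of_support_subset_isCompact (isCompact_closedBall 0 1) support_paraboloid_subset

lemma hasFDerivAt_paraboloid_sq (w : EuclideanSpace ℝ (Fin d)) :
    HasFDerivAt (fun w : EuclideanSpace ℝ (Fin d) => paraboloid w ^ 2)
      ((-4 * paraboloid w) • innerSL ℝ w) w := by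
  have h1 : HasFDerivAt (fun w : EuclideanSpace ℝ (Fin d) => 1 - ‖w‖ ^ 2)
      (-((2 : ℝ) • innerSL ℝ w)) w := by
    convert! ((hasStrictFDerivAt_norm_sq w).hasFDerivAt).const_sub 1 using 2
    rw [two_smul, two_smul]
  have h2 := (hasDerivAt_max_zero_sq (1 - ‖w‖ ^ 2)).comp_hasFDerivAt w h1
  convert! h2 using 1
  rw [paraboloid, smul_neg, ← neg_smul, smul_smul, neg_mul]
  congr 1
  ring

lemma integral_paraboloid_pos : 0 < ∫ w : EuclideanSpace ℝ (Fin d), paraboloid w :=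
  continuous_paraboloid.integral_pos_of_hasCompactSupport_nonneg_nonzero
    hasCompactSupport_paraboloid paraboloid_nonneg (x := 0) (by simp [paraboloid])

/-- The rotation-invariant probability measure with density proportional to `(1 - ‖w‖²)₊`. -/
noncomputable def bumpMeasure (d : ℕ) : Measure (EuclideanSpace ℝ (Fin d)) :=
  volume.withDensity fun w => ENNReal.ofReal
    (paraboloid w / ∫ w : EuclideanSpace ℝ (Fin d), paraboloid w)

lemma continuous_bump_density : Continuous fun w : EuclideanSpace ℝ (Fin d) =>
    paraboloid w / ∫ w : EuclideanSpace ℝ (Fin d), paraboloid w :=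
  continuous_paraboloid.div_const _

lemma integral_bumpMeasure (g : EuclideanSpace ℝ (Fin d) → ℝ) :
    ∫ w, g w ∂(bumpMeasure d) =
      ∫ w, paraboloid w / (∫ w : EuclideanSpace ℝ (Fin d), paraboloid w) * g w := by
  rw [bumpMeasure, integral_withDensity_eq_integral_toReal_smul
    (continuous_bump_density.measurable.ennreal_ofReal) (by simp)]
  refine integral_congr_ae (.of_forall fun w => ?_)
  have : 0 ≤ paraboloid w / ∫ w : EuclideanSpace ℝ (Fin d), paraboloid w :=
    div_nonneg (paraboloid_nonneg w) integral_paraboloid_pos.le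
  simp [ENNReal.toReal_ofReal this]

instance : IsProbabilityMeasure (bumpMeasure d) := by
  refine ⟨?_⟩
  rw [bumpMeasure, withDensity_apply _ MeasurableSet.univ, Measure.restrict_univ,
    ← ofReal_integral_eq_lintegral_ofReal
      ((continuous_paraboloid.integrable_of_hasCompactSupport hasCompactSupport_paraboloid).div_const
        _) (.of_forall fun w => div_nonneg (paraboloid_nonneg w) integral_paraboloid_pos.le),
    integral_div, div_self integral_paraboloid_pos.ne', ENNReal.ofReal_one]

lemma bumpMeasure_compl_closedBall : bumpMeasure d (Metric.closedBall 0 1)ᶜ = 0 := by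
  rw [bumpMeasure, withDensity_apply _ Metric.isClosed_closedBall.measurableSet.compl]
  refine setLIntegral_eq_zero Metric.isClosed_closedBall.measurableSet.compl fun w hw => ?_
  have : paraboloid w = 0 := paraboloid_eq_zero (by simpa using hw)
  simp [this]

lemma lintegral_bumpMeasure_le {g : EuclideanSpace ℝ (Fin d) → ENNReal} (hg : Measurable g) :
    ∫⁻ w, g w ∂(bumpMeasure d) ≤
      ENNReal.ofReal (1 / ∫ w : EuclideanSpace ℝ (Fin d), paraboloid w) * ∫⁻ w, g w := by
  rw [bumpMeasure, lintegral_withDensity_eq_lintegral_mul _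
    continuous_bump_density.measurable.ennreal_ofReal hg, ← lintegral_const_mul _ hg]
  refine lintegral_mono fun w => ?_
  simp only [Pi.mul_apply]
  gcongr
  · exact integral_paraboloid_pos.le
  · exact paraboloid_le_one w

lemma exists_le_bumpMeasure_closedBall (d : ℕ) : ∃ κ : ℝ, 0 < κ ∧
    ∀ z : EuclideanSpace ℝ (Fin d), ‖z‖ ≤ 3 / 8 →
      κ ≤ (bumpMeasure d).real (Metric.closedBall z (1 / 8)) := by
  set Z := ∫ w : EuclideanSpace ℝ (Fin d), paraboloid w with hZ
  have hZpos : 0 < Z := integral_paraboloid_pos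
  have hvol : 0 < volume.real (Metric.closedBall (0 : EuclideanSpace ℝ (Fin d)) (1 / 8)) :=
    ENNReal.toReal_pos (Metric.measure_closedBall_pos _ _ (by norm_num)).ne'
      measure_closedBall_lt_top.ne
  refine ⟨(3 / 4 / Z) * volume.real (Metric.closedBall (0 : EuclideanSpace ℝ (Fin d)) (1 / 8)),
    by positivity, fun z hz => ?_⟩
  have h : ENNReal.ofReal (3 / 4 / Z) * volume (Metric.closedBall z (1 / 8)) ≤
      bumpMeasure d (Metric.closedBall z (1 / 8)) := by
    rw [bumpMeasure, withDensity_apply _ Metric.isClosed_closedBall.measurableSet,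
      ← setLIntegral_const]
    refine setLIntegral_mono' Metric.isClosed_closedBall.measurableSet fun w hw => ?_
    have hw' : ‖w‖ ≤ 1 / 2 := by
      have h1 : ‖w - z‖ ≤ 1 / 8 := by simpa [dist_eq_norm] using hw
      have h2 := norm_add_le (w - z) z
      rw [sub_add_cancel] at h2
      linarith
    gcongr
    exact le_max_of_le_right (by nlinarith [norm_nonneg w])
  have h' := ENNReal.toReal_mono (measure_ne_top _ _) h
  rwa [ENNReal.toReal_mul, ENNReal.toReal_ofReal (by positivity),
    Measure.addHaar_closedBall_center] at h'

/-- Half of the second moment of a coordinate under `bumpMeasure d`. -/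
noncomputable def bumpConst (d : ℕ) : ℝ :=
  (∫ w : EuclideanSpace ℝ (Fin d), paraboloid w ^ 2) /
    (8 * ∫ w : EuclideanSpace ℝ (Fin d), paraboloid w)

lemma hasCompactSupport_paraboloid_sq :
    HasCompactSupport fun w : EuclideanSpace ℝ (Fin d) => paraboloid w ^ 2 := by
  refine hasCompactSupport_paraboloid.mono fun w hw => ?_
  simpa using hw

lemma bumpConst_pos : 0 < bumpConst d := by
  have h : 0 < ∫ w : EuclideanSpace ℝ (Fin d), paraboloid w ^ 2 :=
    (continuous_paraboloid.pow 2).integral_pos_of_hasCompactSupport_nonneg_nonzero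
      hasCompactSupport_paraboloid_sq (fun w => sq_nonneg _) (x := 0) (by simp [paraboloid])
  have := integral_paraboloid_pos (d := d)
  unfold bumpConst
  positivity

variable {f : EuclideanSpace ℝ (Fin d) → ℝ}

lemma integral_fderiv_bumpMeasure (hf : ContDiff ℝ 2 f) (x : EuclideanSpace ℝ (Fin d)) (s : ℝ) :
    ∫ w, fderiv ℝ f (x + s • w) w ∂(bumpMeasure d) =
      s * ((∫ w, (hessianMatrix f (x + s • w)).trace * paraboloid w ^ 2) /
        (4 * ∫ w : EuclideanSpace ℝ (Fin d), paraboloid w)) := by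
  set Z := ∫ w : EuclideanSpace ℝ (Fin d), paraboloid w with hZ
  have hZpos : 0 < Z := integral_paraboloid_pos
  have h1 : ContDiff ℝ 1 (fderiv ℝ f) := hf.fderiv_right (by norm_num)
  have hc1 : Continuous (fderiv ℝ f) := h1.continuous
  have hcomp : ∀ {g : EuclideanSpace ℝ (Fin d) → ℝ}, Continuous g →
      Integrable fun w => g w * paraboloid w ^ 2 := fun hg =>
    (hg.mul (continuous_paraboloid.pow 2)).integrable_of_hasCompactSupport
      hasCompactSupport_paraboloid_sq.mul_left
  have hparts : ∀ i : Fin d,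
      ∫ w, fderiv ℝ f (x + s • w) (EuclideanSpace.single i 1) * (paraboloid w * w i) =
        s / 4 * ∫ w, fderiv ℝ (fderiv ℝ f) (x + s • w) (EuclideanSpace.single i 1)
          (EuclideanSpace.single i 1) * paraboloid w ^ 2 := by
    intro i
    set e : EuclideanSpace ℝ (Fin d) := EuclideanSpace.single i 1 with he
    have hF : ∀ w, HasFDerivAt (fun w => fderiv ℝ f (x + s • w) e)
        ((s • fderiv ℝ (fderiv ℝ f) (x + s • w)).flip e) w := by
      intro w
      have ha : HasFDerivAt (fun w : EuclideanSpace ℝ (Fin d) => x + s • w)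
          (s • ContinuousLinearMap.id ℝ _) w := ((hasFDerivAt_id w).const_smul s).const_add x
      have := ((h1.differentiable one_ne_zero (x + s • w)).hasFDerivAt.comp w ha).clm_apply
        (hasFDerivAt_const e w)
      convert! this using 1
      ext v
      simp
    have hF' : ∀ w, fderiv ℝ (fun w => fderiv ℝ f (x + s • w) e) w e =
        s * fderiv ℝ (fderiv ℝ f) (x + s • w) e e := fun w => by
      rw [(hF w).fderiv]; simp
    have hG' : ∀ w, fderiv ℝ (fun w : EuclideanSpace ℝ (Fin d) => paraboloid w ^ 2) w e =
        -4 * (paraboloid w * w i) := fun w => by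
      rw [(hasFDerivAt_paraboloid_sq w).fderiv]
      simp [he, EuclideanSpace.inner_single_right, mul_assoc]
    have hcHess : Continuous fun w => fderiv ℝ (fderiv ℝ f) (x + s • w) e e :=
      (hf.continuous_fderiv_fderiv_apply e e).comp (by fun_prop)
    have key := integral_mul_fderiv_eq_neg_fderiv_mul_of_integrable
      (μ := (volume : Measure (EuclideanSpace ℝ (Fin d))))
      (f := fun w => fderiv ℝ f (x + s • w) e) (g := fun w => paraboloid w ^ 2) (v := e)
      (by simp only [hF']; exact hcomp (by fun_prop))
      (by
        simp only [hG']
        refine Continuous.integrable_of_hasCompactSupport ?_ ?_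
        · have := continuous_paraboloid (d := d)
          fun_prop
        · refine hasCompactSupport_paraboloid.mono fun w hw => ?_
          simp only [Function.mem_support] at hw ⊢
          contrapose! hw
          simp [hw])
      (hcomp (by fun_prop))
      (fun w _ => (hF w).differentiableAt)
      (fun w _ => (hasFDerivAt_paraboloid_sq w).differentiableAt)
    simp only [hF', hG'] at key
    have e1 : ∀ w, fderiv ℝ f (x + s • w) e * (-4 * (paraboloid w * w i)) =
      -4 * (fderiv ℝ f (x + s • w) e * (paraboloid w * w i)) := fun w => by ring
    have e2 : ∀ w, s * fderiv ℝ (fderiv ℝ f) (x + s • w) e e * paraboloid w ^ 2 =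
      s * (fderiv ℝ (fderiv ℝ f) (x + s • w) e e * paraboloid w ^ 2) := fun w => by ring
    simp only [e1, e2, integral_const_mul] at key
    linarith
  rw [integral_bumpMeasure]
  have e3 : ∀ w : EuclideanSpace ℝ (Fin d), paraboloid w / Z * fderiv ℝ f (x + s • w) w =
      Z⁻¹ * ∑ i, fderiv ℝ f (x + s • w) (EuclideanSpace.single i 1) * (paraboloid w * w i) := by
    intro w
    have hw : w = ∑ i, w i • EuclideanSpace.single i (1 : ℝ) := by
      ext i
      simp [Pi.single_apply]
    conv_lhs => rw [hw, map_sum, ← hw]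
    rw [Finset.mul_sum, Finset.mul_sum]
    refine Finset.sum_congr rfl fun i _ => ?_
    rw [map_smul, smul_eq_mul]
    ring
  simp only [← hZ, e3, trace_hessianMatrix, Finset.sum_mul]
  rw [integral_const_mul, integral_finsetSum, integral_finsetSum]
  · simp only [hparts]
    rw [← Finset.mul_sum]
    field_simp
  · exact fun i _ => hcomp ((hf.continuous_fderiv_fderiv_apply _ _).comp (by fun_prop))
  · intro i _
    refine Continuous.integrable_of_hasCompactSupport ?_ ?_
    · have := continuous_paraboloid (d := d)
      fun_prop
    · refine hasCompactSupport_paraboloid.mono fun w hw => ?_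
      simp only [Function.mem_support] at hw ⊢
      contrapose! hw
      simp [hw]

lemma ContDiff.hasDerivAt_integral_bumpMeasure (hf : ContDiff ℝ 1 f)
    (x : EuclideanSpace ℝ (Fin d)) (s : ℝ) :
    HasDerivAt (fun s : ℝ => ∫ w, f (x + s • w) ∂(bumpMeasure d))
      (∫ w, fderiv ℝ f (x + s • w) w ∂(bumpMeasure d)) s := by
  have h := hf.continuous_fderiv one_ne_zero
  have h0 := hf.continuous
  refine hasDerivAt_integral_of_continuous (isCompact_closedBall 0 1)
    bumpMeasure_compl_closedBall (g := fun s w => f (x + s • w))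
    (g' := fun s w => fderiv ℝ f (x + s • w) w) ?_ ?_
    (fun s w => hf.hasDerivAt_comp_add_smul x w s) s
  · unfold Function.uncurry; fun_prop
  · unfold Function.uncurry; fun_prop

/-- Mean value inequality: an upper bound on the Laplacian bounds the averages. -/
lemma integral_bumpMeasure_le (hf : ContDiff ℝ 2 f) {x : EuclideanSpace ℝ (Fin d)} {ε C : ℝ}
    (hε : 0 ≤ ε) (hC : ∀ y, dist y x ≤ ε → (hessianMatrix f y).trace ≤ C) :
    ∫ w, f (x + ε • w) ∂(bumpMeasure d) ≤ f x + bumpConst d * ε ^ 2 * C := by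
  have hd := (hf.of_le (by norm_num : (1 : WithTop ℕ∞) ≤ 2)).hasDerivAt_integral_bumpMeasure x
  have hb : ∀ s : ℝ, HasDerivAt (fun s => f x + bumpConst d * s ^ 2 * C)
      (2 * s * bumpConst d * C) s := fun s => by
    convert! (((hasDerivAt_pow 2 s).const_mul (bumpConst d)).mul_const C).const_add (f x) using 1
    push_cast; ring
  refine image_le_of_deriv_right_le_deriv_boundary (a := 0) (b := ε)
    (f := fun s : ℝ => ∫ w, f (x + s • w) ∂(bumpMeasure d))
    (B := fun s => f x + bumpConst d * s ^ 2 * C)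
    (fun s _ => (hd s).continuousAt.continuousWithinAt) (fun s _ => (hd s).hasDerivWithinAt)
    (by simp) (fun s _ => (hb s).continuousAt.continuousWithinAt)
    (fun s _ => (hb s).hasDerivWithinAt) ?_ ⟨hε, le_rfl⟩
  rintro s ⟨hs0, hsε⟩
  rw [integral_fderiv_bumpMeasure hf, bumpConst]
  have hZpos : 0 < ∫ w : EuclideanSpace ℝ (Fin d), paraboloid w := integral_paraboloid_pos
  have hle : ∫ w, (hessianMatrix f (x + s • w)).trace * paraboloid w ^ 2 ≤
      ∫ w : EuclideanSpace ℝ (Fin d), C * paraboloid w ^ 2 := by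
    refine integral_mono ?_ ?_ fun w => ?_
    · have h1 := hf.continuous_hessianMatrix
      have h2 := continuous_paraboloid (d := d)
      exact Continuous.integrable_of_hasCompactSupport
        (((h1.matrix_trace).comp (by fun_prop : Continuous fun w => x + s • w)).mul (h2.pow 2))
        hasCompactSupport_paraboloid_sq.mul_left
    · exact (continuous_const.mul (continuous_paraboloid.pow 2)).integrable_of_hasCompactSupport
        hasCompactSupport_paraboloid_sq.mul_left
    · by_cases hw : 1 < ‖w‖
      · simp [paraboloid_eq_zero hw]
      · refine mul_le_mul_of_nonneg_right (hC _ ?_) (sq_nonneg _)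
        rw [dist_eq_norm, add_sub_cancel_left, norm_smul, Real.norm_of_nonneg hs0]
        nlinarith [norm_nonneg w]
  rw [integral_const_mul] at hle
  calc _ ≤ s * ((C * ∫ w : EuclideanSpace ℝ (Fin d), paraboloid w ^ 2) /
        (4 * ∫ w : EuclideanSpace ℝ (Fin d), paraboloid w)) := by gcongr
    _ = _ := by field_simp; ring

end BumpMeasure

section GibbsMeasure

variable {d : ℕ} {V : EuclideanSpace ℝ (Fin d) → ℝ}

/-- The measure with density `exp (-V)`. -/
noncomputable def gibbsMeasure (V : EuclideanSpace ℝ (Fin d) → ℝ) :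
    Measure (EuclideanSpace ℝ (Fin d)) :=
  volume.withDensity fun x => ENNReal.ofReal (Real.exp (-V x))

lemma measurable_gibbs_density (hV : Continuous V) :
    Measurable fun x => ENNReal.ofReal (Real.exp (-V x)) := by fun_prop

lemma gibbsMeasure_eq_zero_iff (hV : Continuous V) {s : Set (EuclideanSpace ℝ (Fin d))} :
    gibbsMeasure V s = 0 ↔ volume s = 0 := by
  rw [gibbsMeasure, withDensity_apply_eq_zero (measurable_gibbs_density hV)]
  have : {x | ENNReal.ofReal (Real.exp (-V x)) ≠ 0} = Set.univ :=
    Set.eq_univ_of_forall fun x => by simpa using Real.exp_pos _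
  rw [this, Set.univ_inter]

end GibbsMeasure

section MongeAmpere

variable {d : ℕ} {φ V W : EuclideanSpace ℝ (Fin d) → ℝ}

lemma ContDiff.continuous_gradient (hφ : ContDiff ℝ 1 φ) :
    Continuous fun x => gradient φ x :=
  (InnerProductSpace.toDual ℝ (EuclideanSpace ℝ (Fin d))).symm.continuous.comp
    (hφ.continuous_fderiv one_ne_zero)

/-- A point where the Hessian is definite is determined by its gradient. -/
lemma ConvexOn.eq_of_gradient_eq (hc : ConvexOn ℝ Set.univ φ) (hφ : ContDiff ℝ 2 φ)
    {x y : EuclideanSpace ℝ (Fin d)} (hx : (hessianMatrix φ x).PosDef)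
    (hxy : gradient φ x = gradient φ y) : x = y := by
  by_contra hne
  have hmono := hc.monotone_fderiv_comp_add_smul (hφ.of_le (by norm_num)) x (y - x)
  have h01 : fderiv ℝ φ x (y - x) = fderiv ℝ φ y (y - x) := by
    rw [← inner_gradient_left, ← inner_gradient_left, hxy]
  have hconst : ∀ s ∈ Set.Icc (0 : ℝ) 1,
      fderiv ℝ φ (x + s • (y - x)) (y - x) = fderiv ℝ φ x (y - x) := by
    intro s hs
    have h0 := hmono hs.1
    have h1 := hmono hs.2
    simp only [zero_smul, add_zero, one_smul, add_sub_cancel] at h0 h1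
    linarith
  have hd := (hφ.hasDerivAt_fderiv_comp_add_smul x (y - x) (y - x) 0).hasDerivWithinAt
    (s := Set.Icc 0 1)
  have hd' := (hasDerivWithinAt_const (0 : ℝ) (Set.Icc (0 : ℝ) 1)
    (fderiv ℝ φ x (y - x))).congr hconst (hconst 0 (by simp))
  have h0 := (uniqueDiffOn_Icc_zero_one 0 (by simp)).eq_deriv _ hd hd'
  have hpos := hx.dotProduct_mulVec_pos (x := (y - x).ofLp)
    (fun h => hne (sub_eq_zero.1 (by ext i; simpa using congrFun h i)).symm)
  rw [star_trivial, dotProduct_hessianMatrix_mulVec] at hpos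
  simp at h0 hpos
  linarith

lemma ContDiff.det_fderiv_gradient (hφ : ContDiff ℝ 2 φ) (x : EuclideanSpace ℝ (Fin d)) :
    HasFDerivAt (fun x => gradient φ x) (fderiv ℝ (fun x => gradient φ x) x) x ∧
      (fderiv ℝ (fun x => gradient φ x) x).det = (hessianMatrix φ x).det := by
  obtain ⟨A, hA, hdet⟩ := hφ.hasFDerivAt_gradient x
  rw [hA.fderiv]
  exact ⟨hA, hdet⟩

lemma ContDiff.continuous_det_hessianMatrix (hφ : ContDiff ℝ 2 φ) :
    Continuous fun x => (hessianMatrix φ x).det :=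
  hφ.continuous_hessianMatrix.matrix_det

lemma det_mul_exp_eq_of_det_ne_zero (hc : ConvexOn ℝ Set.univ φ) (hφ : ContDiff ℝ 2 φ)
    (hV : Continuous V) (hW : Continuous W)
    (hmap : Measure.map (fun x => gradient φ x) (gibbsMeasure V) = gibbsMeasure W) :
    Set.EqOn (fun x => (hessianMatrix φ x).det * Real.exp (-W (gradient φ x)))
      (fun x => Real.exp (-V x)) {x | (hessianMatrix φ x).det ≠ 0} := by
  have hT := (hφ.of_le (by norm_num : (1 : WithTop ℕ∞) ≤ 2)).continuous_gradient
  have hdetc := hφ.continuous_det_hessianMatrix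
  have hdet0 : ∀ x, 0 ≤ (hessianMatrix φ x).det := fun x =>
    (hc.posSemidef_hessianMatrix hφ x).det_nonneg
  set U := {x | (hessianMatrix φ x).det ≠ 0} with hU
  have hUo : IsOpen U := isOpen_ne_fun hdetc continuous_const
  have hinj : ∀ x ∈ U, ∀ y, gradient φ x = gradient φ y → x = y := fun x hx y hxy =>
    hc.eq_of_gradient_eq hφ ((hc.posSemidef_hessianMatrix hφ x).posDef_iff_det_ne_zero.2 hx) hxy
  have hset : ∀ s, MeasurableSet s → s ⊆ U →
      ∫⁻ x in s, ENNReal.ofReal ((hessianMatrix φ x).det * Real.exp (-W (gradient φ x))) =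
        ∫⁻ x in s, ENNReal.ofReal (Real.exp (-V x)) := by
    intro s hs hsU
    have hd : ∀ x ∈ s, HasFDerivWithinAt (fun x => gradient φ x)
      (fderiv ℝ (fun x => gradient φ x) x) s x := fun x _ =>
        (hφ.det_fderiv_gradient x).1.hasFDerivWithinAt
    have hi : Set.InjOn (fun x => gradient φ x) s := fun x hx y _ hxy => hinj x (hsU hx) y hxy
    have him := measurable_image_of_fderivWithin hs hd hi
    have hpre : (fun x => gradient φ x) ⁻¹' ((fun x => gradient φ x) '' s) = s := by
      refine Set.Subset.antisymm ?_ (Set.subset_preimage_image _ _)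
      rintro z ⟨x, hx, hxz⟩
      rwa [← hinj x (hsU hx) z hxz]
    have h1 := lintegral_image_eq_lintegral_abs_det_fderiv_mul volume hs hd hi
      fun p => ENNReal.ofReal (Real.exp (-W p))
    have h2 : gibbsMeasure W ((fun x => gradient φ x) '' s) = gibbsMeasure V s := by
      rw [← hmap, Measure.map_apply hT.measurable him, hpre]
    rw [gibbsMeasure, gibbsMeasure, withDensity_apply _ him, withDensity_apply _ hs, h1] at h2
    rw [← h2]
    refine lintegral_congr fun x => ?_
    rw [(hφ.det_fderiv_gradient x).2, abs_of_nonneg (hdet0 x), ENNReal.ofReal_mul (hdet0 x)]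
  have hcl : Continuous fun x => (hessianMatrix φ x).det * Real.exp (-W (gradient φ x)) := by
    fun_prop
  have hae : (fun x => ENNReal.ofReal
      ((hessianMatrix φ x).det * Real.exp (-W (gradient φ x)))) =ᵐ[volume.restrict U]
      fun x => ENNReal.ofReal (Real.exp (-V x)) := by
    refine ae_eq_of_forall_setLIntegral_eq_of_sigmaFinite (by fun_prop) (by fun_prop) ?_
    intro s hs _
    rw [Measure.restrict_restrict hs]
    exact hset _ (hs.inter hUo.measurableSet) Set.inter_subset_right
  refine Measure.eqOn_open_of_ae_eq (μ := volume) ?_ hUo hcl.continuousOn (by fun_prop)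
  filter_upwards [hae] with x hx
  exact (ENNReal.ofReal_eq_ofReal_iff (mul_nonneg (hdet0 x) (Real.exp_pos _).le)
    (Real.exp_pos _).le).1 hx

/-- The Monge–Ampère equation for a `C²` Brenier potential. -/
lemma det_mul_exp_eq (hc : ConvexOn ℝ Set.univ φ) (hφ : ContDiff ℝ 2 φ)
    (hV : Continuous V) (hW : Continuous W) [NeZero (gibbsMeasure V)]
    (hmap : Measure.map (fun x => gradient φ x) (gibbsMeasure V) = gibbsMeasure W)
    (x : EuclideanSpace ℝ (Fin d)) :
    (hessianMatrix φ x).det * Real.exp (-W (gradient φ x)) = Real.exp (-V x) := by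
  have hT := (hφ.of_le (by norm_num : (1 : WithTop ℕ∞) ≤ 2)).continuous_gradient
  have hdetc := hφ.continuous_det_hessianMatrix
  have hEq := det_mul_exp_eq_of_det_ne_zero hc hφ hV hW hmap
  set U := {x | (hessianMatrix φ x).det ≠ 0} with hU
  have hUo : IsOpen U := isOpen_ne_fun hdetc continuous_const
  have hcl : IsClosed U := by
    rw [← closure_subset_iff_isClosed]
    intro y hy
    have := hEq.closure (by fun_prop) (by fun_prop) hy
    intro h0
    simp only [h0, zero_mul] at this
    exact (Real.exp_pos _).ne this
  rcases isClopen_iff.1 ⟨hcl, hUo⟩ with h | h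
  · exfalso
    have h0 : ∀ x, (hessianMatrix φ x).det = 0 := fun x => by
      by_contra hx
      exact (h ▸ (show x ∈ U from hx) : x ∈ (∅ : Set _))
    have hvol : volume ((fun x => gradient φ x) '' Set.univ) = 0 :=
      addHaar_image_eq_zero_of_det_fderivWithin_eq_zero volume
        (fun x _ => (hφ.det_fderiv_gradient x).1.hasFDerivWithinAt)
        fun x _ => (hφ.det_fderiv_gradient x).2.trans (h0 x)
    rw [← gibbsMeasure_eq_zero_iff hW, ← hmap] at hvol
    have := Measure.le_map_apply (μ := gibbsMeasure V) hT.aemeasurable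
      ((fun x => gradient φ x) '' Set.univ)
    rw [hvol, Set.preimage_image_univ] at this
    exact NeZero.ne (gibbsMeasure V) (Measure.measure_univ_eq_zero.1 (le_antisymm this bot_le))
  · exact hEq (h ▸ Set.mem_univ x)

lemma posDef_and_log_det_hessianMatrix (hc : ConvexOn ℝ Set.univ φ) (hφ : ContDiff ℝ 2 φ)
    (hV : Continuous V) (hW : Continuous W) [NeZero (gibbsMeasure V)]
    (hmap : Measure.map (fun x => gradient φ x) (gibbsMeasure V) = gibbsMeasure W)
    (x : EuclideanSpace ℝ (Fin d)) :
    (hessianMatrix φ x).PosDef ∧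
      Real.log (hessianMatrix φ x).det = W (gradient φ x) - V x := by
  have h := det_mul_exp_eq hc hφ hV hW hmap x
  have hne : (hessianMatrix φ x).det ≠ 0 := fun h0 => by
    rw [h0, zero_mul] at h
    exact (Real.exp_pos _).ne h
  refine ⟨(hc.posSemidef_hessianMatrix hφ x).posDef_iff_det_ne_zero.2 hne, ?_⟩
  have := congrArg Real.log h
  rw [Real.log_mul hne (Real.exp_pos _).ne', Real.log_exp, Real.log_exp] at this
  linarith

lemma denseRange_gradient (hφ : ContDiff ℝ 2 φ) (hW : Continuous W)
    (hmap : Measure.map (fun x => gradient φ x) (gibbsMeasure V) = gibbsMeasure W) :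
    DenseRange fun x => gradient φ x := by
  have hT := (hφ.of_le (by norm_num : (1 : WithTop ℕ∞) ≤ 2)).continuous_gradient
  refine dense_iff_inter_open.2 fun O hO hne => ?_
  by_contra hemp
  rw [Set.not_nonempty_iff_eq_empty] at hemp
  have hpre : (fun x => gradient φ x) ⁻¹' O = ∅ :=
    Set.eq_empty_of_forall_notMem fun x hx =>
      Set.eq_empty_iff_forall_notMem.1 hemp _ ⟨hx, x, rfl⟩
  refine hO.measure_ne_zero volume hne ((gibbsMeasure_eq_zero_iff hW).1 ?_)
  rw [← hmap, Measure.map_apply hT.measurable hO.measurableSet, hpre, measure_empty]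

end MongeAmpere

section Growth

variable {d : ℕ} {φ V W Wstar : EuclideanSpace ℝ (Fin d) → ℝ}

lemma ConvexOn.add_inner_gradient_le (hc : ConvexOn ℝ Set.univ φ) (hφ : ContDiff ℝ 1 φ)
    (x y : EuclideanSpace ℝ (Fin d)) : φ x + ⟪gradient φ x, y - x⟫ ≤ φ y := by
  rw [inner_gradient_left]
  exact hc.add_fderiv_le hφ x y

/-- A convex function whose gradient has dense range grows superlinearly. -/
lemma ConvexOn.exists_mul_norm_sub_le (hc : ConvexOn ℝ Set.univ φ) (hφ : ContDiff ℝ 1 φ)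
    (hd : DenseRange fun x => gradient φ x) (R : ℝ) : ∃ C, ∀ x, R * ‖x‖ - C ≤ φ x := by
  obtain ⟨t, ht⟩ := (isCompact_closedBall (0 : EuclideanSpace ℝ (Fin d))
    |R + 1|).elim_finite_subcover (fun z => Metric.ball (gradient φ z) 1)
    (fun z => Metric.isOpen_ball) fun u _ => by
      obtain ⟨z, hz⟩ := hd.exists_dist_lt u one_pos
      exact Set.mem_iUnion.2 ⟨z, hz⟩
  refine ⟨∑ z ∈ t, |⟪gradient φ z, z⟫ - φ z|, fun x => ?_⟩
  have hu : (R + 1) • (‖x‖⁻¹ • x) ∈ Metric.closedBall (0 : EuclideanSpace ℝ (Fin d)) |R + 1| := by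
    rw [mem_closedBall_zero_iff, norm_smul, Real.norm_eq_abs]
    refine mul_le_of_le_one_right (abs_nonneg _) ?_
    rw [norm_smul, norm_inv, norm_norm]
    exact inv_mul_le_one
  obtain ⟨z, hzt, hz⟩ := Set.mem_iUnion₂.1 (ht hu)
  have h1 := hc.add_inner_gradient_le hφ z x
  have h2 : |⟪gradient φ z, z⟫ - φ z| ≤ ∑ z ∈ t, |⟪gradient φ z, z⟫ - φ z| :=
    Finset.single_le_sum (f := fun z => |⟪gradient φ z, z⟫ - φ z|) (fun _ _ => abs_nonneg _) hzt
  have h3 := le_abs_self (⟪gradient φ z, z⟫ - φ z)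
  have h4 : ⟪(R + 1) • (‖x‖⁻¹ • x) - gradient φ z, x⟫ ≤ ‖x‖ := by
    refine (real_inner_le_norm _ _).trans (mul_le_of_le_one_left (norm_nonneg _) ?_)
    rw [← dist_eq_norm]
    exact (Metric.mem_ball.1 hz).le
  have h5 : ⟪(R + 1) • (‖x‖⁻¹ • x), x⟫ = (R + 1) * ‖x‖ := by
    rw [real_inner_smul_left, real_inner_smul_left, real_inner_self_eq_norm_sq]
    rcases eq_or_ne ‖x‖ 0 with h0 | h0
    · simp [h0]
    · field_simp
  rw [inner_sub_left, h5] at h4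
  rw [inner_sub_right] at h1
  linarith

lemma ConvexOn.le_of_trace_le (hc : ConvexOn ℝ Set.univ φ) (hφ : ContDiff ℝ 2 φ) {C : ℝ}
    (hC : ∀ x, (hessianMatrix φ x).trace ≤ C) (q : EuclideanSpace ℝ (Fin d)) :
    φ q ≤ φ 0 + fderiv ℝ φ 0 q + C * ‖q‖ ^ 2 / 2 := by
  have hφ1 : ContDiff ℝ 1 φ := hφ.of_le (by norm_num)
  have h1 := hφ1.hasDerivAt_comp_add_smul 0 q
  have h2 := hφ.hasDerivAt_fderiv_comp_add_smul 0 q q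
  have hb2 : ∀ s : ℝ, HasDerivAt (fun s => fderiv ℝ φ 0 q + C * ‖q‖ ^ 2 * s)
      (C * ‖q‖ ^ 2) s := fun s => by
    simpa using ((hasDerivAt_id s).const_mul (C * ‖q‖ ^ 2)).const_add (fderiv ℝ φ 0 q)
  have hb1 : ∀ s : ℝ, HasDerivAt (fun s => φ 0 + fderiv ℝ φ 0 q * s + C * ‖q‖ ^ 2 / 2 * s ^ 2)
      (fderiv ℝ φ 0 q + C * ‖q‖ ^ 2 * s) s := fun s => by
    convert! (((hasDerivAt_id s).const_mul (fderiv ℝ φ 0 q)).const_add (φ 0)).add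
      ((hasDerivAt_pow 2 s).const_mul (C * ‖q‖ ^ 2 / 2)) using 1
    push_cast; ring
  have hfirst : ∀ s : ℝ, 0 ≤ s →
      fderiv ℝ φ (0 + s • q) q ≤ fderiv ℝ φ 0 q + C * ‖q‖ ^ 2 * s := by
    intro s hs
    refine image_le_of_deriv_right_le_deriv_boundary (a := 0) (b := s)
      (f := fun s : ℝ => fderiv ℝ φ (0 + s • q) q)
      (B := fun s => fderiv ℝ φ 0 q + C * ‖q‖ ^ 2 * s)
      (fun s _ => (h2 s).continuousAt.continuousWithinAt) (fun s _ => (h2 s).hasDerivWithinAt)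
      (by simp) (fun s _ => (hb2 s).continuousAt.continuousWithinAt)
      (fun s _ => (hb2 s).hasDerivWithinAt) (fun s _ => ?_) ⟨hs, le_rfl⟩
    exact (hc.fderiv_fderiv_le_trace hφ _ q).trans (by gcongr; exact hC _)
  have := image_le_of_deriv_right_le_deriv_boundary (a := 0) (b := 1)
      (f := fun s : ℝ => φ (0 + s • q))
      (B := fun s => φ 0 + fderiv ℝ φ 0 q * s + C * ‖q‖ ^ 2 / 2 * s ^ 2)
      (fun s _ => (h1 s).continuousAt.continuousWithinAt) (fun s _ => (h1 s).hasDerivWithinAt)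
      (by simp) (fun s _ => (hb1 s).continuousAt.continuousWithinAt)
      (fun s _ => (hb1 s).hasDerivWithinAt) (fun s hs => hfirst s hs.1)
      (Set.right_mem_Icc.2 zero_le_one)
  simpa using this

lemma convexOn_of_isLUB_inner_sub (hL : ∀ y : EuclideanSpace ℝ (Fin d),
      IsLUB {z : ℝ | ∃ x : EuclideanSpace ℝ (Fin d), z = ⟪x, y⟫ - W x} (Wstar y)) :
    ConvexOn ℝ Set.univ Wstar := by
  refine ⟨convex_univ, fun x _ y _ a b ha hb hab => (hL _).2 ?_⟩
  rintro _ ⟨p, rfl⟩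
  have h1 := (hL x).1 ⟨p, rfl⟩
  have h2 := (hL y).1 ⟨p, rfl⟩
  rw [inner_add_right, real_inner_smul_right, real_inner_smul_right]
  have h3 := mul_le_mul_of_nonneg_left h1 ha
  have h4 := mul_le_mul_of_nonneg_left h2 hb
  have h5 : W p = a * W p + b * W p := by rw [← add_mul, hab, one_mul]
  simp only [smul_eq_mul]
  linarith

/-- Smoothness of the Legendre transform gives quadratic growth. -/
lemma exists_mul_norm_sq_sub_le (hL : ∀ y : EuclideanSpace ℝ (Fin d),
      IsLUB {z : ℝ | ∃ x : EuclideanSpace ℝ (Fin d), z = ⟪x, y⟫ - W x} (Wstar y))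
    (hWstar : ContDiff ℝ 2 Wstar) {lam : ℝ} (hlam : 0 < lam)
    (hb : ∀ x, (hessianMatrix Wstar x).trace ≤ 1 / lam) :
    ∃ C, ∀ p, lam / 4 * ‖p‖ ^ 2 - C ≤ W p := by
  refine ⟨Wstar 0 + lam * ‖fderiv ℝ Wstar 0‖ ^ 2, fun p => ?_⟩
  have h1 := (hL (lam • p)).1 ⟨p, rfl⟩
  have h2 := (convexOn_of_isLUB_inner_sub hL).le_of_trace_le hWstar hb (lam • p)
  have h3 : fderiv ℝ Wstar 0 p ≤ ‖fderiv ℝ Wstar 0‖ * ‖p‖ :=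
    (le_abs_self _).trans ((fderiv ℝ Wstar 0).le_opNorm p)
  rw [map_smul, norm_smul, Real.norm_of_nonneg hlam.le, mul_pow, smul_eq_mul] at h2
  rw [real_inner_smul_right, real_inner_self_eq_norm_sq] at h1
  have h4 : 1 / lam * (lam ^ 2 * ‖p‖ ^ 2) / 2 = lam / 2 * ‖p‖ ^ 2 := by field_simp
  rw [h4] at h2
  have h5 := mul_le_mul_of_nonneg_left h3 hlam.le
  have h6 := mul_nonneg hlam.le (sq_nonneg (‖p‖ / 2 - ‖fderiv ℝ Wstar 0‖))
  nlinarith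

lemma Continuous.integrable_bumpMeasure {g : EuclideanSpace ℝ (Fin d) → ℝ} (hg : Continuous g) :
    Integrable g (bumpMeasure d) :=
  hg.integrable_of_measure_compl_eq_zero (isCompact_closedBall 0 1) bumpMeasure_compl_closedBall

lemma exists_integral_norm_gradient_sq_le (hφ : ContDiff ℝ 2 φ) (hV : ContDiff ℝ 2 V)
    (hW : Continuous W) {ΛV : ℝ} (hΛ : ∀ x, (hessianMatrix V x).trace ≤ ΛV)
    {a C : ℝ} (ha : 0 < a) (hWa : ∀ p, 2 * a * ‖p‖ ^ 2 - C ≤ W p)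
    (hmap : Measure.map (fun x => gradient φ x) (gibbsMeasure V) = gibbsMeasure W) :
    ∃ C', ∀ r : ℝ, 1 ≤ r →
      ∫ w, a * ‖gradient φ (r • w)‖ ^ 2 ∂(bumpMeasure d) ≤ C' + bumpConst d * r ^ 2 * ΛV := by
  have hT := (hφ.of_le (by norm_num : (1 : WithTop ℕ∞) ≤ 2)).continuous_gradient
  have hVc := hV.continuous
  have hfin : ∫⁻ x, ENNReal.ofReal (Real.exp (a * ‖gradient φ x‖ ^ 2 - V x)) ≠ ⊤ := by
    have h1 : ∫⁻ x, ENNReal.ofReal (Real.exp (a * ‖gradient φ x‖ ^ 2 - V x)) =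
        ∫⁻ p, ENNReal.ofReal (Real.exp (a * ‖p‖ ^ 2)) ∂(gibbsMeasure W) := by
      rw [← hmap, lintegral_map (by fun_prop) hT.measurable, gibbsMeasure,
        lintegral_withDensity_eq_lintegral_mul _ (measurable_gibbs_density hVc) (by fun_prop)]
      refine lintegral_congr fun x => ?_
      rw [Pi.mul_apply, ← ENNReal.ofReal_mul (Real.exp_pos _).le, ← Real.exp_add]
      congr 2; ring
    rw [h1, gibbsMeasure,
      lintegral_withDensity_eq_lintegral_mul _ (measurable_gibbs_density hW) (by fun_prop)]
    have hg : Integrable fun p : EuclideanSpace ℝ (Fin d) =>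
        Real.exp C * Real.exp (-a * ‖p‖ ^ 2) := by
      refine Integrable.const_mul (.of_integral_ne_zero ?_) _
      rw [GaussianFourier.integral_rexp_neg_mul_sq_norm ha]
      positivity
    refine ne_top_of_le_ne_top hg.lintegral_lt_top.ne (lintegral_mono fun p => ?_)
    rw [Pi.mul_apply, ← ENNReal.ofReal_mul (Real.exp_pos _).le, ← Real.exp_add, ← Real.exp_add]
    exact ENNReal.ofReal_le_ofReal (Real.exp_le_exp.2 (by linarith [hWa p]))
  set I := ∫⁻ x, ENNReal.ofReal (Real.exp (a * ‖gradient φ x‖ ^ 2 - V x)) with hI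
  set K := ENNReal.ofReal (1 / ∫ w : EuclideanSpace ℝ (Fin d), paraboloid w) * I with hK
  have hKfin : K ≠ ⊤ := ENNReal.mul_ne_top ENNReal.ofReal_ne_top hfin
  refine ⟨K.toReal - 1 + V 0, fun r hr => ?_⟩
  have hr0 : (0 : ℝ) < r := by linarith
  have hc : Continuous fun w : EuclideanSpace ℝ (Fin d) => a * ‖gradient φ (r • w)‖ ^ 2 := by
    fun_prop
  have hcV : Continuous fun w : EuclideanSpace ℝ (Fin d) => V (r • w) := by fun_prop
  have hexp : ∫ w, Real.exp (a * ‖gradient φ (r • w)‖ ^ 2 - V (r • w)) ∂(bumpMeasure d) ≤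
      K.toReal := by
    rw [integral_eq_lintegral_of_nonneg_ae (.of_forall fun w => (Real.exp_pos _).le)
      (by fun_prop : Continuous _).aestronglyMeasurable]
    refine ENNReal.toReal_mono hKfin ((lintegral_bumpMeasure_le (by fun_prop)).trans ?_)
    rw [hK]
    gcongr
    have hm := Measure.map_addHaar_smul (volume : Measure (EuclideanSpace ℝ (Fin d))) hr0.ne'
    rw [← lintegral_map (f := fun x => ENNReal.ofReal (Real.exp (a * ‖gradient φ x‖ ^ 2 - V x)))
      (g := fun w => r • w) (by fun_prop) (by fun_prop), hm, lintegral_smul_measure, ← hI]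
    refine (mul_le_mul_left ?_ I).trans_eq (one_mul I)
    rw [ENNReal.ofReal_le_one, abs_of_pos (by positivity)]
    exact inv_le_one_of_one_le₀ (one_le_pow₀ hr)
  have hmean := integral_bumpMeasure_le hV (x := 0) hr0.le (C := ΛV) fun y _ => hΛ y
  simp only [zero_add] at hmean
  have hle : ∫ w, (a * ‖gradient φ (r • w)‖ ^ 2 - V (r • w) + 1) ∂(bumpMeasure d) ≤
      ∫ w, Real.exp (a * ‖gradient φ (r • w)‖ ^ 2 - V (r • w)) ∂(bumpMeasure d) :=
    integral_mono (Continuous.integrable_bumpMeasure (by fun_prop))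
      (Continuous.integrable_bumpMeasure (by fun_prop)) fun w => Real.add_one_le_exp _
  rw [integral_add (f := fun w => a * ‖gradient φ (r • w)‖ ^ 2 - V (r • w))
      (hc.sub hcV).integrable_bumpMeasure (integrable_const _),
    integral_sub hc.integrable_bumpMeasure hcV.integrable_bumpMeasure, integral_const, probReal_univ, one_smul] at hle
  linarith

lemma exists_norm_gradient_le (hc : ConvexOn ℝ Set.univ φ) (hφ : ContDiff ℝ 2 φ)
    {a C Λ : ℝ} (ha : 0 < a) (hC : ∀ r : ℝ, 1 ≤ r →
      ∫ w, a * ‖gradient φ (r • w)‖ ^ 2 ∂(bumpMeasure d) ≤ C + bumpConst d * r ^ 2 * Λ) :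
    ∃ C', 0 ≤ C' ∧ ∀ x, ‖gradient φ x‖ ≤ C' * (1 + ‖x‖) := by
  obtain ⟨κ, hκ, hball⟩ := exists_le_bumpMeasure_closedBall d
  have hφ1 : ContDiff ℝ 1 φ := hφ.of_le (by norm_num)
  have hT := hφ1.continuous_gradient
  set M := 64 * (|C| + bumpConst d * |Λ|) with hM
  refine ⟨√(9 * M / (a * κ)), Real.sqrt_nonneg _, fun x => ?_⟩
  set y := gradient φ x with hy
  rcases eq_or_ne y 0 with h0 | h0
  · rw [h0, norm_zero]; positivity
  have hR : 0 < ‖y‖ := norm_pos_iff.2 h0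
  set r := 1 + ‖x‖ with hr
  have hr1 : 1 ≤ r := by simp [hr]
  have hr0 : 0 < r := by linarith
  set θ := ‖y‖⁻¹ • y with hθ
  have hθn : ‖θ‖ = 1 := by rw [hθ, norm_smul, norm_inv, norm_norm, inv_mul_cancel₀ hR.ne']
  have hyθ : ⟪y, θ⟫ = ‖y‖ := by
    rw [hθ, real_inner_smul_right, real_inner_self_eq_norm_sq]
    field_simp
  have hgrad : ∀ e : EuclideanSpace ℝ (Fin d), ‖e‖ ≤ r →
      ‖y‖ / 3 ≤ ‖gradient φ (x + ((2 * r) • θ + e))‖ := by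
    intro e he
    set u := (2 * r) • θ + e with hu
    have h1 := hc.fderiv_sub_fderiv_nonneg hφ1 x (x + u)
    rw [add_sub_cancel_left, ← inner_gradient_left, ← inner_gradient_left, ← hy] at h1
    have h2 : ⟪y, u⟫ = 2 * r * ‖y‖ + ⟪y, e⟫ := by
      rw [hu, inner_add_right, real_inner_smul_right, hyθ]
    have h3 : -(‖y‖ * r) ≤ ⟪y, e⟫ :=
      (neg_le_neg (mul_le_mul_of_nonneg_left he hR.le)).trans
        (abs_le.1 (abs_real_inner_le_norm y e)).1
    have h4 : ‖u‖ ≤ 3 * r := by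
      refine (norm_add_le _ _).trans ?_
      rw [norm_smul, hθn, Real.norm_of_nonneg (by positivity)]
      linarith
    have h5 := (real_inner_le_norm (gradient φ (x + u)) u).trans
      (mul_le_mul_of_nonneg_left h4 (norm_nonneg _))
    have h6 : r * ‖y‖ ≤ r * (3 * ‖gradient φ (x + u)‖) := by linarith
    linarith [le_of_mul_le_mul_left h6 hr0]
  set z := (8 * r)⁻¹ • (x + (2 * r) • θ) with hz
  have hzn : ‖z‖ ≤ 3 / 8 := by
    rw [hz, norm_smul, norm_inv, Real.norm_of_nonneg (by positivity), inv_mul_le_iff₀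
      (by positivity)]
    refine (norm_add_le _ _).trans ?_
    rw [norm_smul, hθn, Real.norm_of_nonneg (by positivity)]
    linarith
  have hsub : Metric.closedBall z (1 / 8) ⊆
      {w | a * (‖y‖ / 3) ^ 2 ≤ a * ‖gradient φ ((8 * r) • w)‖ ^ 2} := by
    intro w hw
    have he : ‖(8 * r) • (w - z)‖ ≤ r := by
      rw [norm_smul, Real.norm_of_nonneg (by positivity), ← dist_eq_norm]
      have := mul_le_mul_of_nonneg_left (Metric.mem_closedBall.1 hw)
        (by positivity : 0 ≤ 8 * r)
      linarith
    have h1 := hgrad _ he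
    have h2 : x + ((2 * r) • θ + (8 * r) • (w - z)) = (8 * r) • w := by
      rw [smul_sub, hz, smul_inv_smul₀ (by positivity)]
      abel
    rw [h2] at h1
    rw [Set.mem_ofPred_eq]
    gcongr
  have hcont : Continuous fun w : EuclideanSpace ℝ (Fin d) =>
      a * ‖gradient φ ((8 * r) • w)‖ ^ 2 := by fun_prop
  have hmarkov := mul_meas_ge_le_integral_of_nonneg
    (μ := bumpMeasure d) (f := fun w => a * ‖gradient φ ((8 * r) • w)‖ ^ 2)
    (.of_forall fun w => by positivity) hcont.integrable_bumpMeasure (a * (‖y‖ / 3) ^ 2)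
  have hκ' := (hball z hzn).trans (measureReal_mono hsub)
  have h1 := (mul_le_mul_of_nonneg_left hκ' (by positivity : 0 ≤ a * (‖y‖ / 3) ^ 2)).trans
    (hmarkov.trans (hC (8 * r) (by linarith)))
  have h2 : C + bumpConst d * (8 * r) ^ 2 * Λ ≤ M * r ^ 2 := by
    have hb := bumpConst_pos (d := d)
    have hC' : C ≤ 64 * |C| * r ^ 2 := by
      nlinarith [le_abs_self C, abs_nonneg C, one_le_pow₀ (n := 2) hr1]
    have hΛ' : bumpConst d * (8 * r) ^ 2 * Λ ≤ bumpConst d * (8 * r) ^ 2 * |Λ| := by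
      gcongr; exact le_abs_self Λ
    rw [hM]
    linarith
  have h3 : ‖y‖ ^ 2 ≤ 9 * M / (a * κ) * r ^ 2 := by
    rw [div_mul_eq_mul_div, le_div_iff₀ (by positivity)]
    linarith
  rw [← Real.sqrt_sq hr0.le, ← Real.sqrt_mul' _ (sq_nonneg r)]
  exact Real.le_sqrt_of_sq_le h3

end Growth

section MaximumPrinciple

variable {d : ℕ} {φ V W Wstar : EuclideanSpace ℝ (Fin d) → ℝ}

/-- The difference between the average of `φ` around `x` at scale `ε` and its value at `x`. -/
noncomputable def bumpGap (φ : EuclideanSpace ℝ (Fin d) → ℝ) (ε : ℝ)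
    (x : EuclideanSpace ℝ (Fin d)) : ℝ :=
  ∫ w, φ (x + ε • w) ∂(bumpMeasure d) - φ x

lemma continuous_bumpGap (hφ : Continuous φ) (ε : ℝ) : Continuous (bumpGap φ ε) := by
  refine Continuous.sub (continuous_integral_of_continuous (isCompact_closedBall 0 1)
    bumpMeasure_compl_closedBall (g := fun x w => φ (x + ε • w)) ?_) hφ
  unfold Function.uncurry; fun_prop

lemma bumpGap_zero (φ : EuclideanSpace ℝ (Fin d) → ℝ) (x : EuclideanSpace ℝ (Fin d)) :
    bumpGap φ 0 x = 0 := by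
  simp [bumpGap]

lemma ConvexOn.bumpGap_le (hc : ConvexOn ℝ Set.univ φ) (hφ : ContDiff ℝ 1 φ) {C : ℝ}
    (hC0 : 0 ≤ C) (hC : ∀ x, ‖gradient φ x‖ ≤ C * (1 + ‖x‖)) {ε : ℝ} (hε : 0 ≤ ε)
    (x : EuclideanSpace ℝ (Fin d)) : bumpGap φ ε x ≤ ε * (C * (1 + ‖x‖ + ε)) := by
  have hφc := hφ.continuous
  have h : ∫ w, φ (x + ε • w) ∂(bumpMeasure d) ≤
      ∫ _, (φ x + ε * (C * (1 + ‖x‖ + ε))) ∂(bumpMeasure d) := by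
    refine integral_mono_ae (Continuous.integrable_bumpMeasure (by fun_prop))
      (integrable_const _) ?_
    filter_upwards [measure_eq_zero_iff_ae_notMem.1 (bumpMeasure_compl_closedBall (d := d))]
      with w hw
    have hw1 : ‖w‖ ≤ 1 := by simpa using hw
    have h1 := hc.add_inner_gradient_le hφ (x + ε • w) x
    have h2 : x - (x + ε • w) = -(ε • w) := by abel
    rw [h2, inner_neg_right, real_inner_smul_right] at h1
    have h3 : ‖x + ε • w‖ ≤ ‖x‖ + ε := by
      refine (norm_add_le _ _).trans ?_
      rw [norm_smul, Real.norm_of_nonneg hε]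
      nlinarith
    have h4 : ‖gradient φ (x + ε • w)‖ ≤ C * (1 + ‖x‖ + ε) :=
      (hC _).trans (mul_le_mul_of_nonneg_left (by linarith) hC0)
    have h5 : ⟪gradient φ (x + ε • w), w⟫ ≤ C * (1 + ‖x‖ + ε) :=
      (real_inner_le_norm _ _).trans ((mul_le_of_le_one_right (norm_nonneg _) hw1).trans h4)
    linarith [mul_le_mul_of_nonneg_left h5 hε]
  rw [integral_const, probReal_univ, one_smul] at h
  rw [bumpGap]
  linarith

lemma ConvexOn.bumpGap_sub_le (hc : ConvexOn ℝ Set.univ φ) (hφ : ContDiff ℝ 1 φ) (s ε : ℝ)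
    (x : EuclideanSpace ℝ (Fin d)) : bumpGap φ ε x - bumpGap φ s x ≤
      (ε - s) * ∫ w, ⟪gradient φ (x + ε • w), w⟫ ∂(bumpMeasure d) := by
  have hφc := hφ.continuous
  have hT := hφ.continuous_gradient
  have hi : ∀ s : ℝ, Integrable (fun w => φ (x + s • w)) (bumpMeasure d) := fun s =>
    Continuous.integrable_bumpMeasure (by fun_prop)
  rw [bumpGap, bumpGap, sub_sub_sub_cancel_right, ← integral_sub (hi ε) (hi s),
    ← integral_const_mul]
  refine integral_mono ((hi ε).sub (hi s)) (Continuous.integrable_bumpMeasure (by fun_prop))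
    fun w => ?_
  have h1 := hc.add_inner_gradient_le hφ (x + ε • w) (x + s • w)
  have h2 : x + s • w - (x + ε • w) = -((ε - s) • w) := by rw [sub_smul]; abel
  rw [h2, inner_neg_right, real_inner_smul_right] at h1
  simp only
  linarith

lemma exists_forall_bumpGap_sub_le (hc : ConvexOn ℝ Set.univ φ) (hφ : ContDiff ℝ 1 φ) {C : ℝ}
    (hC0 : 0 ≤ C) (hC : ∀ x, ‖gradient φ x‖ ≤ C * (1 + ‖x‖))
    (hsup : ∀ R, ∃ C, ∀ x, R * ‖x‖ - C ≤ φ x) {ε η : ℝ} (hε : 0 ≤ ε) (hη : 0 < η) :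
    ∃ x₀, ∀ x, bumpGap φ ε x - η * φ x ≤ bumpGap φ ε x₀ - η * φ x₀ := by
  refine Continuous.exists_forall_ge
    ((continuous_bumpGap hφ.continuous ε).sub (hφ.continuous.const_mul η)) ?_
  obtain ⟨B, hB⟩ := hsup ((ε * C + 1) / η)
  have hlim : Filter.Tendsto (fun x : EuclideanSpace ℝ (Fin d) =>
      (ε * (C * (1 + ε)) + η * B) + -‖x‖) (Filter.cocompact _) Filter.atBot :=
    Filter.tendsto_atBot_add_const_left _ _
      (Filter.tendsto_neg_atTop_atBot.comp (tendsto_norm_cocompact_atTop))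
  refine Filter.tendsto_atBot_mono (fun x => ?_) hlim
  have h1 := hc.bumpGap_le hφ hC0 hC hε x
  have h2 := mul_le_mul_of_nonneg_left (hB x) hη.le
  have h3 : η * ((ε * C + 1) / η * ‖x‖ - B) = (ε * C + 1) * ‖x‖ - η * B := by field_simp
  rw [h3] at h2
  linarith

/-- First and second order conditions at a maximum point. -/
lemma integral_eq_and_integral_le_of_max (hφ : ContDiff ℝ 2 φ) {ε η : ℝ}
    {x₀ : EuclideanSpace ℝ (Fin d)}
    (hmax : ∀ x, bumpGap φ ε x - η * φ x ≤ bumpGap φ ε x₀ - η * φ x₀)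
    (v : EuclideanSpace ℝ (Fin d)) :
    ∫ w, ⟪gradient φ (x₀ + ε • w), v⟫ ∂(bumpMeasure d) = (1 + η) * ⟪gradient φ x₀, v⟫ ∧
    ∫ w, fderiv ℝ (fderiv ℝ φ) (x₀ + ε • w) v v ∂(bumpMeasure d) ≤
      (1 + η) * fderiv ℝ (fderiv ℝ φ) x₀ v v := by
  have hφ1 : ContDiff ℝ 1 φ := hφ.of_le (by norm_num)
  have hc0 := hφ.continuous
  have hc1 := hφ1.continuous_fderiv one_ne_zero
  have hc2 := hφ.continuous_fderiv_fderiv_apply v v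
  have h1 : ∀ s : ℝ, HasDerivAt (fun s : ℝ => ∫ w, φ (x₀ + ε • w + s • v) ∂(bumpMeasure d) -
      (1 + η) * φ (x₀ + s • v)) (∫ w, fderiv ℝ φ (x₀ + ε • w + s • v) v ∂(bumpMeasure d) -
      (1 + η) * fderiv ℝ φ (x₀ + s • v) v) s := by
    intro s
    refine (hasDerivAt_integral_of_continuous (isCompact_closedBall 0 1)
      bumpMeasure_compl_closedBall (g := fun s w => φ (x₀ + ε • w + s • v))
      (g' := fun s w => fderiv ℝ φ (x₀ + ε • w + s • v) v) ?_ ?_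
      (fun s w => hφ1.hasDerivAt_comp_add_smul _ v s) s).sub
      ((hφ1.hasDerivAt_comp_add_smul x₀ v s).const_mul (1 + η))
    · unfold Function.uncurry; fun_prop
    · unfold Function.uncurry; fun_prop
  have h2 : HasDerivAt (fun s : ℝ => ∫ w, fderiv ℝ φ (x₀ + ε • w + s • v) v ∂(bumpMeasure d) -
      (1 + η) * fderiv ℝ φ (x₀ + s • v) v)
      (∫ w, fderiv ℝ (fderiv ℝ φ) (x₀ + ε • w + (0 : ℝ) • v) v v ∂(bumpMeasure d) -
      (1 + η) * fderiv ℝ (fderiv ℝ φ) (x₀ + (0 : ℝ) • v) v v) 0 := by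
    refine (hasDerivAt_integral_of_continuous (isCompact_closedBall 0 1)
      bumpMeasure_compl_closedBall (g := fun s w => fderiv ℝ φ (x₀ + ε • w + s • v) v)
      (g' := fun s w => fderiv ℝ (fderiv ℝ φ) (x₀ + ε • w + s • v) v v) ?_ ?_
      (fun s w => hφ.hasDerivAt_fderiv_comp_add_smul _ v v s) 0).sub
      ((hφ.hasDerivAt_fderiv_comp_add_smul x₀ v v 0).const_mul (1 + η))
    · unfold Function.uncurry; fun_prop
    · exact hc2.comp (by fun_prop : Continuous fun q : ℝ × EuclideanSpace ℝ (Fin d) =>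
        x₀ + ε • q.2 + q.1 • v)
  have hloc : IsLocalMax (fun s : ℝ => ∫ w, φ (x₀ + ε • w + s • v) ∂(bumpMeasure d) -
      (1 + η) * φ (x₀ + s • v)) 0 := by
    refine Filter.Eventually.of_forall fun s => ?_
    have := hmax (x₀ + s • v)
    simp only [bumpGap, add_right_comm x₀ (s • v)] at this
    simp only [zero_smul, add_zero]
    linarith
  have hfirst := hloc.hasDerivAt_eq_zero (h1 0)
  have hsecond := hloc.second_deriv_nonpos h1 h2
  simp only [zero_smul, add_zero] at hfirst hsecond
  simp only [inner_gradient_left]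
  constructor <;> linarith

lemma integral_comp_gradient_le (hφ : ContDiff ℝ 2 φ) (hV : ContDiff ℝ 2 V) (hW : Continuous W)
    {ΛV : ℝ} (hΛ : ∀ x, (hessianMatrix V x).trace ≤ ΛV)
    (hMA : ∀ x, (hessianMatrix φ x).PosDef ∧
      Real.log (hessianMatrix φ x).det = W (gradient φ x) - V x)
    {ε η : ℝ} (hε : 0 ≤ ε) {x₀ : EuclideanSpace ℝ (Fin d)}
    (hmax : ∀ x, bumpGap φ ε x - η * φ x ≤ bumpGap φ ε x₀ - η * φ x₀) :
    ∫ w, W (gradient φ (x₀ + ε • w)) ∂(bumpMeasure d) ≤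
      W (gradient φ x₀) + bumpConst d * ε ^ 2 * ΛV + η * d := by
  have hT := (hφ.of_le (by norm_num : (1 : WithTop ℕ∞) ≤ 2)).continuous_gradient
  have hVc := hV.continuous
  obtain ⟨v, hv, hle⟩ := (hMA x₀).1.exists_log_det_le
  rw [Fintype.card_fin] at hv hle
  simp only [dotProduct_hessianMatrix_mulVec] at hv
  have hc2 : ∀ j, Continuous fun w => fderiv ℝ (fderiv ℝ φ) (x₀ + ε • w) (WithLp.toLp 2 (v j))
      (WithLp.toLp 2 (v j)) := fun j =>
    (hφ.continuous_fderiv_fderiv_apply _ _).comp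
      (by fun_prop : Continuous fun w : EuclideanSpace ℝ (Fin d) => x₀ + ε • w)
  have hcW : Continuous fun w => W (gradient φ (x₀ + ε • w)) := by fun_prop
  have hcV : Continuous fun w => V (x₀ + ε • w) := by fun_prop
  have hint : ∫ w, (W (gradient φ (x₀ + ε • w)) - V (x₀ + ε • w)) ∂(bumpMeasure d) ≤
      ∫ w, ((W (gradient φ x₀) - V x₀ - d) + ∑ j, fderiv ℝ (fderiv ℝ φ) (x₀ + ε • w)
        (WithLp.toLp 2 (v j)) (WithLp.toLp 2 (v j))) ∂(bumpMeasure d) := by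
    refine integral_mono (hcW.sub hcV).integrable_bumpMeasure
      (Continuous.integrable_bumpMeasure (by fun_prop)) fun w => ?_
    have h := hle _ (hMA (x₀ + ε • w)).1
    rw [(hMA _).2, (hMA _).2] at h
    simp only [dotProduct_hessianMatrix_mulVec] at h
    simp only
    linarith
  rw [integral_sub hcW.integrable_bumpMeasure hcV.integrable_bumpMeasure,
    integral_add (integrable_const _) (Continuous.integrable_bumpMeasure (by fun_prop)),
    integral_const, probReal_univ, one_smul,
    integral_finsetSum _ fun j _ => (hc2 j).integrable_bumpMeasure] at hint
  have hsum : ∑ j, ∫ w, fderiv ℝ (fderiv ℝ φ) (x₀ + ε • w) (WithLp.toLp 2 (v j))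
      (WithLp.toLp 2 (v j)) ∂(bumpMeasure d) ≤ (1 + η) * d := by
    rw [← hv, Finset.mul_sum]
    exact Finset.sum_le_sum fun j _ => (integral_eq_and_integral_le_of_max hφ hmax _).2
  have hmean := integral_bumpMeasure_le hV (x := x₀) hε (C := ΛV) fun y _ => hΛ y
  linarith

lemma le_integral_comp_gradient (hφ : ContDiff ℝ 2 φ) (hW : ContDiff ℝ 2 W)
    (hWc : ConvexOn ℝ Set.univ W) (hWstar : ContDiff ℝ 2 Wstar)
    (hL : ∀ y : EuclideanSpace ℝ (Fin d),
      IsLUB {z : ℝ | ∃ x : EuclideanSpace ℝ (Fin d), z = ⟪x, y⟫ - W x} (Wstar y))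
    {L : ℝ} (hb : ∀ x, (hessianMatrix Wstar x).trace ≤ L)
    {ε η t : ℝ} (hη : 0 ≤ η) (ht : 0 ≤ t) {x₀ : EuclideanSpace ℝ (Fin d)}
    (hmax : ∀ x, bumpGap φ ε x - η * φ x ≤ bumpGap φ ε x₀ - η * φ x₀) :
    W (gradient φ x₀) - η * (Wstar 0 + W 0) +
        t * ∫ w, ⟪gradient φ (x₀ + ε • w), w⟫ ∂(bumpMeasure d) - bumpConst d * t ^ 2 * L ≤
      ∫ w, W (gradient φ (x₀ + ε • w)) ∂(bumpMeasure d) := by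
  have hT := (hφ.of_le (by norm_num : (1 : WithTop ℕ∞) ≤ 2)).continuous_gradient
  have hWcont := hW.continuous
  have hWscont := hWstar.continuous
  set p := gradient φ x₀ with hp
  set q := gradient W p with hq
  have hsub := hWc.add_inner_gradient_le (hW.of_le (by norm_num)) p
  rw [← hq] at hsub
  have hstar : Wstar q ≤ ⟪p, q⟫ - W p := by
    refine (hL q).2 ?_
    rintro _ ⟨z, rfl⟩
    have := hsub z
    rw [inner_sub_right, real_inner_comm, real_inner_comm p] at this
    linarith
  have hpq : -(Wstar 0 + W 0) ≤ ⟪p, q⟫ := by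
    have h1 := hsub 0
    have h2 := (hL 0).1 ⟨p, rfl⟩
    rw [zero_sub, inner_neg_right, real_inner_comm] at h1
    rw [inner_zero_right] at h2
    linarith
  have hc1 : Continuous fun w => ⟪gradient φ (x₀ + ε • w), q⟫ := by fun_prop
  have hc2 : Continuous fun w => t * ⟪gradient φ (x₀ + ε • w), w⟫ := by fun_prop
  have hc3 : Continuous fun w => Wstar (q + t • w) := by fun_prop
  have hint : ∫ w, (⟪gradient φ (x₀ + ε • w), q⟫ + t * ⟪gradient φ (x₀ + ε • w), w⟫ -
      Wstar (q + t • w)) ∂(bumpMeasure d) ≤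
      ∫ w, W (gradient φ (x₀ + ε • w)) ∂(bumpMeasure d) := by
    refine integral_mono ((hc1.add hc2).sub hc3).integrable_bumpMeasure
      (Continuous.integrable_bumpMeasure (by fun_prop)) fun w => ?_
    have := (hL (q + t • w)).1 ⟨gradient φ (x₀ + ε • w), rfl⟩
    rw [inner_add_right, real_inner_smul_right] at this
    simp only
    linarith
  rw [integral_sub (f := fun w => ⟪gradient φ (x₀ + ε • w), q⟫ +
      t * ⟪gradient φ (x₀ + ε • w), w⟫) (hc1.add hc2).integrable_bumpMeasure
      hc3.integrable_bumpMeasure,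
    integral_add hc1.integrable_bumpMeasure hc2.integrable_bumpMeasure, integral_const_mul,
    (integral_eq_and_integral_le_of_max hφ hmax q).1] at hint
  have hmean := integral_bumpMeasure_le hWstar (x := q) ht (C := L) fun y _ => hb y
  have := mul_le_mul_of_nonneg_left hpq hη
  linarith

end MaximumPrinciple

section LaplacianBound

variable {d : ℕ} {φ V W Wstar : EuclideanSpace ℝ (Fin d) → ℝ}

lemma mul_bumpGap_sub_le (hc : ConvexOn ℝ Set.univ φ) (hφ : ContDiff ℝ 2 φ)
    (hV : ContDiff ℝ 2 V) (hW : ContDiff ℝ 2 W)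
    (hWc : ConvexOn ℝ Set.univ W) (hWstar : ContDiff ℝ 2 Wstar)
    (hL : ∀ y : EuclideanSpace ℝ (Fin d),
      IsLUB {z : ℝ | ∃ x : EuclideanSpace ℝ (Fin d), z = ⟪x, y⟫ - W x} (Wstar y))
    {ΛV L C : ℝ} (hΛ : ∀ x, (hessianMatrix V x).trace ≤ ΛV)
    (hb : ∀ x, (hessianMatrix Wstar x).trace ≤ L)
    (hMA : ∀ x, (hessianMatrix φ x).PosDef ∧
      Real.log (hessianMatrix φ x).det = W (gradient φ x) - V x)
    (hC0 : 0 ≤ C) (hC : ∀ x, ‖gradient φ x‖ ≤ C * (1 + ‖x‖))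
    (hsup : ∀ R, ∃ C, ∀ x, R * ‖x‖ - C ≤ φ x)
    {s ε t B : ℝ} (hs : 0 ≤ s) (hsε : s ≤ ε) (ht : 0 ≤ t) (hB : ∀ x, bumpGap φ s x ≤ B)
    (x₁ : EuclideanSpace ℝ (Fin d)) :
    t * (bumpGap φ ε x₁ - B) ≤ (ε - s) * (bumpConst d * (t ^ 2 * L + ε ^ 2 * ΛV)) := by
  have hφ1 : ContDiff ℝ 1 φ := hφ.of_le (by norm_num)
  have hε : 0 ≤ ε := hs.trans hsε
  obtain ⟨M, hM⟩ := hsup 0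
  have key : ∀ η : ℝ, 0 < η → t * (bumpGap φ ε x₁ - B) - η * (t * (φ x₁ + M)) ≤
      (ε - s) * (bumpConst d * (t ^ 2 * L + ε ^ 2 * ΛV)) +
        η * ((ε - s) * (d + (Wstar 0 + W 0))) := by
    intro η hη
    obtain ⟨x₀, hmax⟩ := exists_forall_bumpGap_sub_le hc hφ1 hC0 hC hsup hε hη
    have h1 := integral_comp_gradient_le hφ hV hW.continuous hΛ hMA hε hmax
    have h2 := le_integral_comp_gradient hφ hW hWc hWstar hL hb hη.le ht hmax
    have h3 := hc.bumpGap_sub_le hφ1 s ε x₀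
    have h4 : bumpGap φ ε x₁ - B - η * (φ x₁ + M) ≤ bumpGap φ ε x₀ - bumpGap φ s x₀ := by
      have h5 := hmax x₁
      have h6 := hB x₀
      have h7 := mul_le_mul_of_nonneg_left (hM x₀) hη.le
      linarith
    have h8 := mul_le_mul_of_nonneg_left (h4.trans h3) ht
    have h9 := mul_le_mul_of_nonneg_left (h2.trans h1) (sub_nonneg.2 hsε)
    linarith
  have hl : Filter.Tendsto
      (fun η : ℝ => t * (bumpGap φ ε x₁ - B) - η * (t * (φ x₁ + M)))
      (nhdsWithin 0 (Set.Ioi 0)) (nhds (t * (bumpGap φ ε x₁ - B))) := by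
    have : Continuous fun η : ℝ => t * (bumpGap φ ε x₁ - B) - η * (t * (φ x₁ + M)) := by fun_prop
    simpa using (this.tendsto 0).mono_left nhdsWithin_le_nhds
  have hr : Filter.Tendsto
      (fun η : ℝ => (ε - s) * (bumpConst d * (t ^ 2 * L + ε ^ 2 * ΛV)) +
        η * ((ε - s) * (d + (Wstar 0 + W 0))))
      (nhdsWithin 0 (Set.Ioi 0))
      (nhds ((ε - s) * (bumpConst d * (t ^ 2 * L + ε ^ 2 * ΛV)))) := by
    have : Continuous fun η : ℝ => (ε - s) * (bumpConst d * (t ^ 2 * L + ε ^ 2 * ΛV)) +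
      η * ((ε - s) * (d + (Wstar 0 + W 0))) := by fun_prop
    simpa using (this.tendsto 0).mono_left nhdsWithin_le_nhds
  exact le_of_tendsto_of_tendsto hl hr
    (Filter.eventually_of_mem self_mem_nhdsWithin fun η hη => key η hη)

/-- A self-improving gap estimate, iterated to its fixed point. -/
lemma le_of_forall_mul_sub_le {X : Type*} {F : ℝ → X → ℝ} {c Λ L : ℝ} (hΛ : 0 < Λ)
    (hL : 0 < L) (h0 : ∀ x, F 0 x ≤ 0)
    (hF : ∀ s ε t B, 0 ≤ s → s ≤ ε → 0 ≤ t → (∀ x, F s x ≤ B) → ∀ x,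
      t * (F ε x - B) ≤ (ε - s) * (c * (t ^ 2 * L + ε ^ 2 * Λ)))
    {ε : ℝ} (hε : 0 < ε) (x : X) : F ε x ≤ √(Λ * L) * c * ε ^ 2 := by
  set K := √(Λ * L) with hK
  have hKpos : 0 < K := Real.sqrt_pos.2 (by positivity)
  have hKsq : K ^ 2 = Λ * L := Real.sq_sqrt (by positivity)
  have step : ∀ s ε B, 0 ≤ s → s ≤ ε → 0 < ε → (∀ x, F s x ≤ B) → ∀ x,
      F ε x ≤ B + 2 * (ε - s) * c * ε * K := by
    intro s ε B hs hsε hε hB x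
    have ht : 0 < ε * K / L := by positivity
    have h := hF s ε (ε * K / L) B hs hsε ht.le hB x
    have h1 : (ε - s) * (c * ((ε * K / L) ^ 2 * L + ε ^ 2 * Λ)) =
        ε * K / L * (2 * (ε - s) * c * ε * K) := by
      field_simp
      rw [hKsq]
      ring
    rw [h1] at h
    linarith [le_of_mul_le_mul_left h ht]
  have hn : ∀ n : ℕ, ∀ ε, 0 < ε → ∀ x, F ε x ≤ (n + 2) / (n + 1) * (K * c * ε ^ 2) := by
    intro n
    induction n with
    | zero =>
      intro ε hε x
      have := step 0 ε 0 le_rfl hε.le hε h0 x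
      norm_num
      linarith
    | succ n ih =>
      intro ε hε x
      have hσ : ((n : ℝ) + 1) / (n + 2) * ε ≤ ε := by
        refine mul_le_of_le_one_left hε.le ?_
        rw [div_le_one (by positivity)]
        linarith
      refine (step ((n + 1) / (n + 2) * ε) ε _ (by positivity) hσ hε
        (ih _ (by positivity)) x).trans_eq ?_
      push_cast
      field_simp
      ring
  have hlim : Filter.Tendsto (fun n : ℕ => ((n : ℝ) + 2) / (n + 1) * (K * c * ε ^ 2))
      Filter.atTop (nhds (K * c * ε ^ 2)) := by
    have h1 : Filter.Tendsto (fun n : ℕ => 1 + 1 / ((n : ℝ) + 1)) Filter.atTop (nhds (1 + 0)) :=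
      tendsto_one_div_add_atTop_nhds_zero_nat.const_add 1
    have h2 := h1.mul_const (K * c * ε ^ 2)
    rw [add_zero, one_mul] at h2
    refine h2.congr fun n => ?_
    field_simp
    ring
  exact ge_of_tendsto' hlim fun n => hn n ε hε x

lemma hessianMatrix_neg (f : EuclideanSpace ℝ (Fin d) → ℝ) (x : EuclideanSpace ℝ (Fin d)) :
    hessianMatrix (-f) x = -hessianMatrix f x := by
  ext i j
  have : fderiv ℝ (-f) = -fderiv ℝ f := by
    ext1 y; exact fderiv_neg
  rw [Matrix.neg_apply, hessianMatrix_apply, hessianMatrix_apply, this, fderiv_neg]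
  rfl

lemma trace_hessianMatrix_le_of_bumpGap_le (hφ : ContDiff ℝ 2 φ) {K : ℝ}
    {x : EuclideanSpace ℝ (Fin d)}
    (hK : ∀ ε : ℝ, 0 < ε → bumpGap φ ε x ≤ K * bumpConst d * ε ^ 2) :
    (hessianMatrix φ x).trace ≤ K := by
  by_contra! hlt
  obtain ⟨b, hKb, hb⟩ := exists_between hlt
  have hcont : Continuous fun y => (hessianMatrix φ y).trace :=
    hφ.continuous_hessianMatrix.matrix_trace
  obtain ⟨ε, hε, hball⟩ := Metric.nhds_basis_closedBall.mem_iff.1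
    (hcont.continuousAt.eventually_const_lt hb)
  have h := integral_bumpMeasure_le hφ.neg (x := x) hε.le (C := -b) fun y hy => by
    have h1 := hball (Metric.mem_closedBall.2 hy)
    change (hessianMatrix (-φ) y).trace ≤ -b
    rw [hessianMatrix_neg, trace_neg]
    exact neg_le_neg (le_of_lt h1)
  rw [integral_neg] at h
  have h2 := hK ε hε
  rw [bumpGap] at h2
  have h3 : 0 < (b - K) * (bumpConst d * ε ^ 2) :=
    mul_pos (sub_pos.2 hKb) (mul_pos bumpConst_pos (by positivity))
  linarith

end LaplacianBound

/-- Gozlan–Sylvestre: if `ΔV ≤ Λ_V` and `ΔW* ≤ 1/λ_W`, then the Brenier map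
`∇φ` from `μ = e^{-V}dx` to `ν = e^{-W}dx` satisfies `Δφ ≤ √(Λ_V/λ_W)`. -/
theorem laplacian_bound_brenier {d : ℕ} (hd : 1 ≤ d)
    (V W Wstar : EuclideanSpace ℝ (Fin d) → ℝ)
    (hV : ContDiff ℝ 2 V) (hW : ContDiff ℝ 2 W) (hWstar : ContDiff ℝ 2 Wstar)
    (hWconv : ConvexOn ℝ Set.univ W)
    (hLegendre : ∀ y : EuclideanSpace ℝ (Fin d),
      IsLUB {z : ℝ | ∃ x : EuclideanSpace ℝ (Fin d), z = ⟪x, y⟫ - W x} (Wstar y))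
    (μ ν : Measure (EuclideanSpace ℝ (Fin d)))
    (hμ : μ = volume.withDensity fun x => ENNReal.ofReal (Real.exp (-V x)))
    (hν : ν = volume.withDensity fun x => ENNReal.ofReal (Real.exp (-W x)))
    (hμprob : IsProbabilityMeasure μ) (hνprob : IsProbabilityMeasure ν)
    (ΛV lamW : ℝ) (hΛV : 0 < ΛV) (hlamW : 0 < lamW)
    (hVbound : ∀ x, (hessianMatrix V x).trace ≤ ΛV)
    (hWstarbound : ∀ x, (hessianMatrix Wstar x).trace ≤ 1 / lamW)
    (φ : EuclideanSpace ℝ (Fin d) → ℝ)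
    (hφ : ContDiff ℝ 2 φ) (hφconv : ConvexOn ℝ Set.univ φ)
    (hpush : Measure.map (fun x => gradient φ x) μ = ν) :
    ∀ x, (hessianMatrix φ x).trace ≤ Real.sqrt (ΛV / lamW) := by
  subst hμ hν
  have hmap : Measure.map (fun x => gradient φ x) (gibbsMeasure V) = gibbsMeasure W := hpush
  have : NeZero (gibbsMeasure V) := ⟨hμprob.ne_zero⟩
  have hφ1 : ContDiff ℝ 1 φ := hφ.of_le (by norm_num)
  have hMA := posDef_and_log_det_hessianMatrix hφconv hφ hV.continuous hW.continuous hmap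
  have hsup := hφconv.exists_mul_norm_sub_le hφ1 (denseRange_gradient hφ hW.continuous hmap)
  obtain ⟨C₁, hC₁⟩ := exists_mul_norm_sq_sub_le hLegendre hWstar hlamW hWstarbound
  have ha : 0 < lamW / 8 := by positivity
  obtain ⟨C₂, hC₂⟩ := exists_integral_norm_gradient_sq_le hφ hV hW.continuous hVbound ha
    (fun p => (by linarith [hC₁ p] : 2 * (lamW / 8) * ‖p‖ ^ 2 - C₁ ≤ W p)) hmap
  obtain ⟨C, hC0, hC⟩ := exists_norm_gradient_le hφconv hφ ha hC₂
  intro x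
  refine trace_hessianMatrix_le_of_bumpGap_le hφ fun ε hε => ?_
  rw [div_eq_mul_one_div]
  exact le_of_forall_mul_sub_le hΛV (one_div_pos.2 hlamW)
    (fun x => (bumpGap_zero φ x).le)
    (fun s ε t B hs hsε ht hB x => mul_bumpGap_sub_le hφconv hφ hV hW hWconv hWstar hLegendre
      hVbound hWstarbound hMA hC0 hC hsup hs hsε ht hB x) hε x
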